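/- arXiv:2305.18833 — 2 statements merged into one kernel-verified Lean document; each statement's English description precedes it below -/
import Mathlib

section
/- (Theorem 5.1, part 1: σ_n in terms of the auxiliary quantities.) For every integer n ≥ 1 and every t ∈ U with R_{n,j}(t) ≠ 0 for all 1 ≤ j ≤ N: σ_n(t) = 2·p(n,t); σ_n(t) = 2Σ_{j=1}^N t_j·r_{n,j}(t) − (n + Σ_{j=1}^N r_{n,j}(t))·Σ_{j=1}^N R_{n,j}(t) − 2Σ_{j=1}^N (r_{n,j}(t)² − γ_j·r_{n,j}(t))/R_{n,j}(t); and ∂_jσ_n(t) = 2·r_{n,j}(t) for each 1 ≤ j ≤ N. -/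
open MeasureTheory Polynomial

noncomputable def pd {N : ℕ} (j : Fin N) (f : (Fin N → ℝ) → ℝ) (x : Fin N → ℝ) : ℝ :=
  deriv (fun s => f (Function.update x j s)) (x j)

section Algebra

variable {I : ℝ[X] →ₗ[ℝ] ℝ} {P : ℕ → ℝ[X]}

lemma degree_sub_C_mul_lt {p q : ℝ[X]} {n : ℕ} (hp : p.Monic) (hd : p.natDegree = n)
    (hq : q.natDegree ≤ n) : (q - C (q.coeff n) * p).degree < n := by
  rw [degree_lt_iff_coeff_zero]
  intro m hm
  rcases hm.eq_or_lt with rfl | hm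
  · have : p.coeff p.natDegree = 1 := hp
    rw [hd] at this
    simp [this]
  · simp [coeff_eq_zero_of_natDegree_lt (hd.trans_lt hm),
      coeff_eq_zero_of_natDegree_lt (hq.trans_lt hm)]

lemma pairing_eq_zero (hm : ∀ n, (P n).Monic) (hd : ∀ n, (P n).natDegree = n)
    (ho : ∀ m n, m ≠ n → I (P m * P n) = 0) {n : ℕ} {q : ℝ[X]} (hq : q.degree < n) :
    I (P n * q) = 0 := by
  suffices H : ∀ k ≤ n, ∀ q : ℝ[X], q.degree < k → I (P n * q) = 0 from H n le_rfl q hq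
  intro k
  induction k with
  | zero =>
    intro _ q hq
    have : q = 0 := by
      rw [← degree_eq_bot]
      simpa using hq
    simp [this]
  | succ k ih =>
    intro hk q hq
    have hqn : q.natDegree ≤ k :=
      natDegree_le_iff_coeff_eq_zero.2 ((degree_lt_iff_coeff_zero _ _).1 hq)
    have h1 := ih (by omega) _ (degree_sub_C_mul_lt (hm k) (hd k) hqn)
    have h2 := ho n k (by omega)
    have e : P n * (q - C (q.coeff k) * P k) = P n * q - q.coeff k • (P n * P k) := by
      rw [smul_eq_C_mul]; ring
    rw [e, map_sub, map_smul, h2] at h1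
    simpa using h1

lemma pairing_eq (hm : ∀ n, (P n).Monic) (hd : ∀ n, (P n).natDegree = n)
    (ho : ∀ m n, m ≠ n → I (P m * P n) = 0) {n : ℕ} {q : ℝ[X]} (hq : q.natDegree ≤ n) :
    I (P n * q) = q.coeff n * I (P n * P n) := by
  have h1 := pairing_eq_zero hm hd ho (degree_sub_C_mul_lt (hm n) (hd n) hq)
  have e : P n * (q - C (q.coeff n) * P n) = P n * q - q.coeff n • (P n * P n) := by
    rw [smul_eq_C_mul]; ring
  rw [e, map_sub, map_smul, sub_eq_zero] at h1
  exact h1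

lemma pairing_of_sub (hm : ∀ n, (P n).Monic) (hd : ∀ n, (P n).natDegree = n)
    (ho : ∀ m n, m ≠ n → I (P m * P n) = 0) {n : ℕ} {q : ℝ[X]} {c : ℝ}
    (hq : q.natDegree ≤ n + 1) (hc : q.coeff (n + 1) = c) :
    I (P n * q) = (q.coeff n - c * (P (n + 1)).coeff n) * I (P n * P n) := by
  have h1 : (q - C c * P (n + 1)).natDegree ≤ n := by
    have := degree_sub_C_mul_lt (hm (n + 1)) (hd (n + 1)) hq
    rw [hc] at this
    exact natDegree_le_iff_coeff_eq_zero.2 ((degree_lt_iff_coeff_zero _ _).1 this)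
  have h2 := pairing_eq hm hd ho h1
  have e : P n * (q - C c * P (n + 1)) = P n * q - c • (P n * P (n + 1)) := by
    rw [smul_eq_C_mul]; ring
  rw [e, map_sub, map_smul, ho n (n + 1) (by omega)] at h2
  simpa using h2

lemma coeff_self_eq_one (hm : ∀ n, (P n).Monic) (hd : ∀ n, (P n).natDegree = n) (n : ℕ) :
    (P n).coeff n = 1 := by
  have : (P n).coeff (P n).natDegree = 1 := hm n
  rwa [hd] at this

lemma natDegree_X_mul_le {q : ℝ[X]} {n : ℕ} (hq : q.natDegree ≤ n) :
    (X * q).natDegree ≤ n + 1 := by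
  refine natDegree_mul_le.trans ?_
  rw [natDegree_X]; omega

lemma pairing_X_mul_self (hm : ∀ n, (P n).Monic) (hd : ∀ n, (P n).natDegree = n)
    (ho : ∀ m n, m ≠ n → I (P m * P n) = 0) (n : ℕ) :
    I (X * (P n * P n)) =
      ((X * P n).coeff n - (X * P (n + 1)).coeff (n + 1)) * I (P n * P n) := by
  have := pairing_of_sub hm hd ho (n := n) (q := X * P n) (c := 1)
    (natDegree_X_mul_le (hd n).le) (by simp [coeff_self_eq_one hm hd])
  rw [show X * (P n * P n) = P n * (X * P n) by ring, this, coeff_X_mul, one_mul]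

lemma pairing_X_mul_succ (hm : ∀ n, (P n).Monic) (hd : ∀ n, (P n).natDegree = n)
    (ho : ∀ m n, m ≠ n → I (P m * P n) = 0) (n : ℕ) :
    I (X * (P (n + 1) * P n)) = I (P (n + 1) * P (n + 1)) := by
  have := pairing_eq hm hd ho (n := n + 1) (q := X * P n) (natDegree_X_mul_le (hd n).le)
  rw [show X * (P (n + 1) * P n) = P (n + 1) * (X * P n) by ring, this, coeff_X_mul,
    coeff_self_eq_one hm hd, one_mul]

lemma pairing_X_sq_mul_succ (hm : ∀ n, (P n).Monic) (hd : ∀ n, (P n).natDegree = n)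
    (ho : ∀ m n, m ≠ n → I (P m * P n) = 0) (n : ℕ) :
    I (X * (X * (P (n + 1) * P n))) =
      ((X * P n).coeff n - (X * P (n + 2)).coeff (n + 2)) * I (P (n + 1) * P (n + 1)) := by
  have := pairing_of_sub hm hd ho (n := n + 1) (q := X * (X * P n)) (c := 1)
    (natDegree_X_mul_le (natDegree_X_mul_le (hd n).le)) (by simp [coeff_self_eq_one hm hd])
  rw [show X * (X * (P (n + 1) * P n)) = P (n + 1) * (X * (X * P n)) by ring, this,
    coeff_X_mul, coeff_X_mul, one_mul]

lemma pairing_derivative_self (hm : ∀ n, (P n).Monic) (hd : ∀ n, (P n).natDegree = n)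
    (ho : ∀ m n, m ≠ n → I (P m * P n) = 0) (n : ℕ) :
    I (derivative (P n * P n)) = 0 := by
  have h1 : I (P n * derivative (P n)) = 0 :=
    pairing_eq_zero hm hd ho (by
      have := degree_derivative_lt (hm n).ne_zero
      rwa [degree_eq_natDegree (hm n).ne_zero, hd] at this)
  rw [derivative_mul, mul_comm, ← two_mul, ← C_ofNat, ← smul_eq_C_mul, map_smul, h1, smul_zero]

lemma pairing_derivative_succ (hm : ∀ n, (P n).Monic) (hd : ∀ n, (P n).natDegree = n)
    (ho : ∀ m n, m ≠ n → I (P m * P n) = 0) (n : ℕ) :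
    I (derivative (P (n + 1) * P n)) = (n + 1) * I (P n * P n) := by
  have h1 : I (P (n + 1) * derivative (P n)) = 0 :=
    pairing_eq_zero hm hd ho (by
      have := degree_derivative_lt (hm n).ne_zero
      rw [degree_eq_natDegree (hm n).ne_zero, hd] at this
      exact this.trans (by exact_mod_cast n.lt_succ_self))
  have h2 : I (P n * derivative (P (n + 1))) = (n + 1) * I (P n * P n) := by
    rw [pairing_eq hm hd ho ((natDegree_derivative_le _).trans (by simp [hd]))]
    rw [coeff_derivative, coeff_self_eq_one hm hd, one_mul]
  rw [derivative_mul, map_add, h1, mul_comm, h2, add_zero]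

lemma pairing_derivative_X_mul_succ (hm : ∀ n, (P n).Monic) (hd : ∀ n, (P n).natDegree = n)
    (ho : ∀ m n, m ≠ n → I (P m * P n) = 0) (n : ℕ) :
    I (derivative (X * (P (n + 1) * P n))) =
      -(X * P (n + 1)).coeff (n + 1) * I (P n * P n) := by
  have h1 : I (P (n + 1) * (X * derivative (P n))) = 0 := by
    rw [pairing_eq hm hd ho (natDegree_X_mul_le ((natDegree_derivative_le _).trans (by simp [hd])))]
    rw [coeff_X_mul, coeff_derivative,
      coeff_eq_zero_of_natDegree_lt ((hd n).trans_lt n.lt_succ_self)]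
    simp
  have h2 : I (P n * (X * derivative (P (n + 1)))) =
      -(X * P (n + 1)).coeff (n + 1) * I (P n * P n) := by
    rw [pairing_of_sub hm hd ho (c := n + 1)
      (natDegree_X_mul_le ((natDegree_derivative_le _).trans (by simp [hd])))
      (by rw [coeff_X_mul, coeff_derivative, coeff_self_eq_one hm hd, one_mul])]
    have : (X * derivative (P (n + 1))).coeff n = n * (P (n + 1)).coeff n := by
      cases n with
      | zero => simp
      | succ k => rw [coeff_X_mul, coeff_derivative]; push_cast; ring
    rw [this, coeff_X_mul]
    ring
  have e : derivative (X * (P (n + 1) * P n)) = P (n + 1) * P n +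
      P n * (X * derivative (P (n + 1))) + P (n + 1) * (X * derivative (P n)) := by
    simp only [derivative_mul, derivative_X]; ring
  rw [e, map_add, map_add, h1, h2, ho _ _ (by omega)]
  ring

/-- The product identity between the ladder quantities at a single singularity `t`. -/
lemma ladder_product_eq {J : ℝ[X] →ₗ[ℝ] ℝ} {c t : ℝ}
    (hJ : ∀ q, J ((X - C t) * q) = c * I q)
    (hm : ∀ n, (P n).Monic) (hd : ∀ n, (P n).natDegree = n)
    (ho : ∀ m n, m ≠ n → I (P m * P n) = 0) (n : ℕ) :
    J (P (n + 1) * P n) * (J (P (n + 1) * P n) - c * I (P n * P n)) =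
      J (P (n + 1) * P (n + 1)) * J (P n * P n) := by
  have key : ∀ p q : ℝ[X], J (p * q) = p.eval t * J q + c * I (q * (p /ₘ (X - C t))) := by
    intro p q
    have hp := modByMonic_add_div p (X - C t)
    rw [modByMonic_X_sub_C_eq_C_eval] at hp
    have : p * q = p.eval t • q + (X - C t) * (q * (p /ₘ (X - C t))) := by
      conv_lhs => rw [← hp]
      rw [smul_eq_C_mul]; ring
    rw [this, map_add, map_smul, hJ, smul_eq_mul]
  have hdeg : ∀ m, (P m /ₘ (X - C t)).natDegree = m - 1 := by
    intro m
    rw [natDegree_divByMonic _ (monic_X_sub_C t), hd, natDegree_X_sub_C]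
  have hlow : ∀ k m, m ≤ k → I (P k * (P m /ₘ (X - C t))) = 0 := by
    intro k m hmk
    by_cases h0 : m = 0
    · subst h0
      rw [divByMonic_eq_zero_iff (monic_X_sub_C t) |>.2, mul_zero, map_zero]
      rw [degree_X_sub_C, degree_eq_natDegree (hm 0).ne_zero, hd]
      exact zero_lt_one
    · refine pairing_eq_zero hm hd ho (lt_of_le_of_lt degree_le_natDegree ?_)
      rw [hdeg]
      exact_mod_cast (by omega : m - 1 < k)
  have htop : I (P n * (P (n + 1) /ₘ (X - C t))) = I (P n * P n) := by
    rw [pairing_eq hm hd ho (by simp [hdeg])]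
    have : (P (n + 1) /ₘ (X - C t)).coeff n = 1 := by
      have h1 := leadingCoeff_divByMonic_of_monic (monic_X_sub_C t)
        (p := P (n + 1)) (by
          rw [degree_X_sub_C, degree_eq_natDegree (hm _).ne_zero, hd]
          exact_mod_cast (by omega : 1 ≤ n + 1))
      rw [leadingCoeff, hdeg] at h1
      simpa using h1.trans (hm (n + 1))
    rw [this, one_mul]
  have e1 := key (P (n + 1)) (P n)
  have e2 := key (P n) (P (n + 1))
  have e3 := key (P (n + 1)) (P (n + 1))
  have e4 := key (P n) (P n)
  rw [htop] at e1
  rw [hlow _ _ (by omega), mul_comm (P n)] at e2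
  rw [hlow _ _ le_rfl] at e3 e4
  rw [e3, e4]
  nth_rewrite 1 [e2]
  rw [e1]
  ring

end Algebra

section Analysis

open Real Filter Topology

/-- `f` grows more slowly than every Gaussian `exp (ε * y ^ 2)` with `ε > 0`. -/
def SubGaussianGrowth (f : ℝ → ℝ) : Prop :=
  ∀ ε > 0, ∃ C, ∀ y, |f y| ≤ C * exp (ε * y ^ 2)

namespace SubGaussianGrowth

lemma const (c : ℝ) : SubGaussianGrowth fun _ => c := by
  intro ε hε
  refine ⟨|c|, fun y => ?_⟩
  have : 1 ≤ exp (ε * y ^ 2) := one_le_exp (by positivity)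
  exact le_mul_of_one_le_right (abs_nonneg c) this

lemma id : SubGaussianGrowth fun y => y := by
  intro ε hε
  refine ⟨1 + 1 / ε, fun y => ?_⟩
  have h1 : ε * y ^ 2 + 1 ≤ exp (ε * y ^ 2) := add_one_le_exp _
  have h2 : |y| ≤ 1 + y ^ 2 := by nlinarith [sq_nonneg (|y| - 1), sq_abs y, abs_nonneg y]
  have h3 : y ^ 2 ≤ 1 / ε * exp (ε * y ^ 2) := by
    rw [div_mul_eq_mul_div, one_mul, le_div_iff₀ hε]
    linarith
  have h4 : 0 ≤ ε * y ^ 2 := by positivity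
  linarith

variable {f g : ℝ → ℝ}

lemma add (hf : SubGaussianGrowth f) (hg : SubGaussianGrowth g) :
    SubGaussianGrowth fun y => f y + g y := by
  intro ε hε
  obtain ⟨A, hA⟩ := hf ε hε
  obtain ⟨B, hB⟩ := hg ε hε
  refine ⟨A + B, fun y => (abs_add_le _ _).trans ?_⟩
  linarith [hA y, hB y]

lemma mul (hf : SubGaussianGrowth f) (hg : SubGaussianGrowth g) :
    SubGaussianGrowth fun y => f y * g y := by
  intro ε hε
  obtain ⟨A, hA⟩ := hf (ε / 2) (by positivity)
  obtain ⟨B, hB⟩ := hg (ε / 2) (by positivity)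
  refine ⟨A * B, fun y => ?_⟩
  have e : exp (ε * y ^ 2) = exp (ε / 2 * y ^ 2) * exp (ε / 2 * y ^ 2) := by
    rw [← exp_add]; ring_nf
  rw [abs_mul, e, mul_mul_mul_comm]
  exact mul_le_mul (hA y) (hB y) (abs_nonneg _) ((abs_nonneg _).trans (hA y))

lemma abs_rpow (hf : SubGaussianGrowth f) {c : ℝ} (hc : 0 < c) :
    SubGaussianGrowth fun y => |f y| ^ c := by
  intro ε hε
  obtain ⟨A, hA⟩ := hf (ε / c) (by positivity)
  have hA0 : 0 ≤ A := by simpa using (abs_nonneg _).trans (hA 0)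
  refine ⟨A ^ c, fun y => ?_⟩
  rw [abs_of_nonneg (by positivity)]
  refine (rpow_le_rpow (abs_nonneg _) (hA y) hc.le).trans_eq ?_
  rw [mul_rpow hA0 (exp_pos _).le, ← exp_mul]
  field_simp

lemma prod {ι : Type*} (s : Finset ι) {F : ι → ℝ → ℝ} (h : ∀ i, SubGaussianGrowth (F i)) :
    SubGaussianGrowth fun y => ∏ i ∈ s, F i y := by
  classical
  induction s using Finset.induction_on with
  | empty => simpa using const 1
  | insert i s hi ih => simpa only [Finset.prod_insert hi] using (h i).mul ih

lemma eval (q : ℝ[X]) : SubGaussianGrowth fun y => q.eval y := by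
  induction q using Polynomial.induction_on' with
  | add p q hp hq => simpa only [eval_add] using hp.add hq
  | monomial n a =>
    have : SubGaussianGrowth fun y => ∏ i ∈ Finset.range n, y := prod _ fun _ => id
    simpa [Finset.prod_const] using (const a).mul this

lemma exp_bound (hf : SubGaussianGrowth f) {a b : ℝ} (hab : b < a)
    (hg : ∃ C, ∀ y, |g y| ≤ C * exp (-a * y ^ 2)) :
    ∃ C, ∀ y, |f y * g y| ≤ C * exp (-b * y ^ 2) := by
  obtain ⟨A, hA⟩ := hf (a - b) (by linarith)
  obtain ⟨B, hB⟩ := hg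
  refine ⟨A * B, fun y => ?_⟩
  have e : exp (-b * y ^ 2) = exp ((a - b) * y ^ 2) * exp (-a * y ^ 2) := by
    rw [← exp_add]; ring_nf
  rw [abs_mul, e, mul_mul_mul_comm]
  exact mul_le_mul (hA y) (hB y) (abs_nonneg _) ((abs_nonneg _).trans (hA y))

end SubGaussianGrowth

lemma integrable_of_le_gaussian {g : ℝ → ℝ} (hg : Continuous g) {b : ℝ} (hb : 0 < b)
    (h : ∃ C, ∀ y, |g y| ≤ C * exp (-b * y ^ 2)) : Integrable g := by
  obtain ⟨C, hC⟩ := h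
  exact ((integrable_exp_neg_mul_sq hb).const_mul C).mono' hg.aestronglyMeasurable
    (Eventually.of_forall hC)

lemma tendsto_zero_of_le_gaussian {g : ℝ → ℝ} {l : Filter ℝ} {b : ℝ} (hb : 0 < b)
    (h : ∃ C, ∀ y, |g y| ≤ C * exp (-b * y ^ 2)) (hl : Tendsto (fun y : ℝ => y ^ 2) l atTop) :
    Tendsto g l (𝓝 0) := by
  obtain ⟨C, hC⟩ := h
  refine squeeze_zero_norm hC ?_
  have h1 : Tendsto (fun y : ℝ => -b * y ^ 2) l atBot :=
    hl.const_mul_atTop_of_neg (by linarith)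
  simpa using (tendsto_exp_atBot.comp h1).const_mul C

lemma hasDerivAt_abs_rpow_of_ne_zero {u : ℝ} (hu : u ≠ 0) (c : ℝ) :
    HasDerivAt (fun u : ℝ => |u| ^ c) (c * (|u| ^ c / u)) u := by
  have h := (hasDerivAt_abs hu).rpow_const (p := c) (Or.inl (abs_ne_zero.2 hu))
  convert h using 1
  rw [rpow_sub (abs_pos.2 hu), rpow_one]
  rcases hu.lt_or_gt with hu | hu
  · rw [abs_of_neg hu, sign_neg hu]; simp; field_simp
  · simp [abs_of_pos hu, sign_pos hu]

lemma continuous_abs_sub_rpow {c : ℝ} (hc : 0 < c) (s : ℝ) :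
    Continuous fun y : ℝ => |y - s| ^ c :=
  (continuous_abs.comp (continuous_id.sub continuous_const)).rpow_const fun _ => Or.inr hc.le

lemma integrable_gaussian_mul_abs_rpow_div {c b : ℝ} (hc : 0 < c) (hb : 0 < b) :
    Integrable fun u : ℝ => exp (-b * u ^ 2) * (|u| ^ c / u) := by
  have h0 := integrableOn_rpow_mul_exp_neg_mul_sq hb (s := c - 1) (by linarith)
  have h1 : IntegrableOn (fun u : ℝ => exp (-b * u ^ 2) * (|u| ^ c / u)) (Set.Ioi 0) := by
    refine h0.congr_fun (fun u hu => ?_) measurableSet_Ioi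
    have hu : 0 < u := hu
    simp only
    rw [abs_of_pos hu, rpow_sub hu, rpow_one, mul_comm]
  have h2 : IntegrableOn (fun u : ℝ => exp (-b * u ^ 2) * (|u| ^ c / u)) (Set.Iic 0) := by
    rw [integrableOn_Iic_iff_integrableOn_Iio]
    rw [← neg_zero] at h1
    have h3 := h1.neg.comp_neg_Iio
    refine h3.congr_fun (fun u _ => ?_) measurableSet_Iio
    simp [div_neg]
  rw [← integrableOn_univ, ← Set.Iic_union_Ioi (a := (0 : ℝ))]
  exact h2.union h1

lemma exp_neg_add_sq_le {u s S : ℝ} (hs : |s| ≤ S) :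
    exp (-(1 / 2) * (u + s) ^ 2) ≤ exp (S ^ 2 / 2) * exp (-(1 / 4) * u ^ 2) := by
  rw [← exp_add]
  apply exp_le_exp.2
  have : s ^ 2 ≤ S ^ 2 := sq_le_sq' (by linarith [neg_abs_le s]) (by linarith [le_abs_self s])
  nlinarith [sq_nonneg (u + 2 * s)]

lemma measurable_abs_rpow_div (c : ℝ) : Measurable fun u : ℝ => |u| ^ c / u := by
  fun_prop

lemma abs_mul_kernel_le {g : ℝ → ℝ} {C : ℝ} (hC : ∀ y, |g y| ≤ C * exp (-(1 / 2) * y ^ 2))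
    {c s S : ℝ} (hs : |s| ≤ S) (u : ℝ) :
    ‖g (u + s) * (|u| ^ c / u)‖ ≤
      C * exp (S ^ 2 / 2) * ‖exp (-(1 / 4) * u ^ 2) * (|u| ^ c / u)‖ := by
  have hC0 : 0 ≤ C := by simpa using (abs_nonneg _).trans (hC 0)
  rw [norm_mul, norm_mul, ← mul_assoc]
  refine mul_le_mul_of_nonneg_right ?_ (norm_nonneg _)
  rw [norm_of_nonneg (exp_pos _).le, mul_assoc]
  exact (hC _).trans (mul_le_mul_of_nonneg_left (exp_neg_add_sq_le hs) hC0)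

variable {g : ℝ → ℝ} {c : ℝ}

lemma integrable_shift_mul_kernel (hg : Continuous g)
    (hC : ∃ C, ∀ y, |g y| ≤ C * exp (-(1 / 2) * y ^ 2)) (hc : 0 < c) (s : ℝ) :
    Integrable fun u => g (u + s) * (|u| ^ c / u) := by
  obtain ⟨C, hC⟩ := hC
  refine (((integrable_gaussian_mul_abs_rpow_div hc (b := 1 / 4) (by norm_num)).norm).const_mul
    (C * exp (|s| ^ 2 / 2))).mono' ?_ (Eventually.of_forall (abs_mul_kernel_le hC le_rfl))
  exact ((hg.comp (continuous_id.add continuous_const)).measurable.mul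
    (measurable_abs_rpow_div c)).aestronglyMeasurable

lemma integrable_mul_kernel (hg : Continuous g)
    (hC : ∃ C, ∀ y, |g y| ≤ C * exp (-(1 / 2) * y ^ 2)) (hc : 0 < c) (s : ℝ) :
    Integrable fun y => g y * (|y - s| ^ c / (y - s)) := by
  simpa using (integrable_shift_mul_kernel hg hC hc s).comp_sub_right s

lemma integral_shift_mul_kernel (g : ℝ → ℝ) (c s : ℝ) :
    ∫ y, g y * (|y - s| ^ c / (y - s)) = ∫ u, g (u + s) * (|u| ^ c / u) := by
  simpa using integral_sub_right_eq_self (fun u => g (u + s) * (|u| ^ c / u)) s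

lemma continuous_integral_mul_kernel (hg : Continuous g)
    (hC : ∃ C, ∀ y, |g y| ≤ C * exp (-(1 / 2) * y ^ 2)) (hc : 0 < c) :
    Continuous fun s => ∫ y, g y * (|y - s| ^ c / (y - s)) := by
  simp_rw [integral_shift_mul_kernel]
  obtain ⟨C, hC⟩ := hC
  rw [continuous_iff_continuousAt]
  intro s₀
  refine continuousAt_of_dominated
    (bound := fun u => C * exp ((|s₀| + 1) ^ 2 / 2) *
      ‖exp (-(1 / 4) * u ^ 2) * (|u| ^ c / u)‖) ?_ ?_ ?_ ?_
  · exact Eventually.of_forall fun s =>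
      ((hg.comp (continuous_id.add continuous_const)).measurable.mul
        (measurable_abs_rpow_div c)).aestronglyMeasurable
  · have : ∀ᶠ s in 𝓝 s₀, |s| < |s₀| + 1 :=
      continuous_abs.continuousAt.eventually_lt continuousAt_const (by linarith)
    filter_upwards [this] with s hs
    exact Eventually.of_forall (abs_mul_kernel_le hC hs.le)
  · exact ((integrable_gaussian_mul_abs_rpow_div hc (by norm_num)).norm).const_mul _
  · exact Eventually.of_forall fun u => by fun_prop

lemma integrable_prod_mul_kernel (hg : Continuous g)
    (hC : ∃ C, ∀ y, |g y| ≤ C * exp (-(1 / 2) * y ^ 2)) (hc : 0 < c) (a b : ℝ) :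
    Integrable (Function.uncurry fun s y => g y * (|y - s| ^ c / (y - s)))
      ((volume.restrict (Set.uIoc a b)).prod volume) := by
  have hmeas : Measurable (Function.uncurry fun s y => g y * (|y - s| ^ c / (y - s))) := by
    exact (hg.measurable.comp measurable_snd).mul
      ((measurable_abs_rpow_div c).comp (measurable_snd.sub measurable_fst))
  rw [integrable_prod_iff hmeas.aestronglyMeasurable]
  refine ⟨Eventually.of_forall fun s => integrable_mul_kernel hg hC hc s, ?_⟩
  have h1 : ∀ s, ∫ y, ‖g y * (|y - s| ^ c / (y - s))‖ = ∫ u, ‖g (u + s) * (|u| ^ c / u)‖ :=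
    fun s => by
      simpa using integral_sub_right_eq_self (fun u => ‖g (u + s) * (|u| ^ c / u)‖) s
  obtain ⟨C, hC'⟩ := id hC
  have hK := ((integrable_gaussian_mul_abs_rpow_div hc (b := 1 / 4) (by norm_num)).norm).const_mul
    (C * exp ((|a| + |b|) ^ 2 / 2))
  refine Measure.integrableOn_of_bounded (M := ∫ u, C * exp ((|a| + |b|) ^ 2 / 2) *
    ‖exp (-(1 / 4) * u ^ 2) * (|u| ^ c / u)‖) (by simp [Set.uIoc]) ?_ ?_
  · exact hmeas.norm.stronglyMeasurable.integral_prod_right.aestronglyMeasurable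
  · refine (ae_restrict_iff' measurableSet_uIoc).2 (Eventually.of_forall fun s hs => ?_)
    rw [norm_of_nonneg (integral_nonneg fun _ => norm_nonneg _)]
    simp only [Function.uncurry]
    rw [h1]
    refine integral_mono (integrable_shift_mul_kernel hg hC hc s).norm hK
      (abs_mul_kernel_le hC' ?_)
    have := Set.uIoc_subset_uIcc hs
    rw [Set.mem_uIcc] at this
    rw [abs_le]
    rcases this with h | h <;> constructor <;>
      linarith [le_abs_self a, le_abs_self b, neg_abs_le a, neg_abs_le b,
        abs_nonneg a, abs_nonneg b]

lemma intervalIntegrable_kernel (hc : 0 < c) (y a b : ℝ) :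
    IntervalIntegrable (fun s => |y - s| ^ c / (y - s)) volume a b := by
  have h : IntervalIntegrable (fun u : ℝ => |u| ^ c / u) volume (y - a) (y - b) := by
    have h1 : IntervalIntegrable (fun u : ℝ => exp (-1 * u ^ 2) * (|u| ^ c / u)) volume
        (y - a) (y - b) :=
      (integrable_gaussian_mul_abs_rpow_div hc one_pos).intervalIntegrable
    have h2 := h1.continuousOn_mul
      (g := fun u => exp (1 * u ^ 2)) (by fun_prop)
    refine h2.congr (fun u _ => ?_)
    rw [← mul_assoc, ← exp_add]
    simp
  simpa using h.comp_sub_left y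

lemma abs_rpow_sub_abs_rpow (hc : 0 < c) (y a b : ℝ) :
    |y - b| ^ c - |y - a| ^ c = -(c * ∫ s in a..b, |y - s| ^ c / (y - s)) := by
  have := integral_eq_of_hasDerivAt_off_countable (a := a) (b := b) (fun s => |y - s| ^ c)
    (fun s => -(c * (|y - s| ^ c / (y - s)))) (s := {y}) (Set.countable_singleton y)
    (by
      have := (continuous_abs_sub_rpow hc 0).comp
        (continuous_const.sub continuous_id : Continuous fun s => y - s)
      simpa [Function.comp_def] using this.continuousOn)
    (fun s hs => by
      have hys : y - s ≠ 0 := sub_ne_zero.2 (Ne.symm hs.2)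
      have := (hasDerivAt_abs_rpow_of_ne_zero hys c).comp s ((hasDerivAt_id s).const_sub y)
      simpa [Function.comp_def] using this)
    (((intervalIntegrable_kernel hc y a b).const_mul c).neg)
  rw [← this, intervalIntegral.integral_neg, intervalIntegral.integral_const_mul]

lemma integrable_mul_abs_rpow (hg : Continuous g)
    (hC : ∃ C, ∀ y, |g y| ≤ C * exp (-(1 / 2) * y ^ 2)) (hc : 0 < c) (s : ℝ) :
    Integrable fun y => g y * |y - s| ^ c := by
  have h1 : SubGaussianGrowth fun y => |y - s| ^ c :=
    (SubGaussianGrowth.id.add (SubGaussianGrowth.const (-s))).abs_rpow hc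
  have h2 := h1.exp_bound (b := 1 / 4) (by norm_num) hC
  exact integrable_of_le_gaussian (hg.mul (continuous_abs_sub_rpow hc s))
    (by norm_num : (0 : ℝ) < 1 / 4) (by simpa only [mul_comm] using h2)

lemma hasDerivAt_integral_mul_abs_rpow (hg : Continuous g)
    (hC : ∃ C, ∀ y, |g y| ≤ C * exp (-(1 / 2) * y ^ 2)) (hc : 0 < c) (s₀ : ℝ) :
    HasDerivAt (fun s => ∫ y, g y * |y - s| ^ c)
      (-(c * ∫ y, g y * (|y - s₀| ^ c / (y - s₀)))) s₀ := by
  have hcont := continuous_integral_mul_kernel hg hC hc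
  have key : ∀ s, ∫ y, g y * |y - s| ^ c = (∫ y, g y * |y - s₀| ^ c) +
      -(c * ∫ r in s₀..s, ∫ y, g y * (|y - r| ^ c / (y - r))) := by
    intro s
    rw [← sub_eq_iff_eq_add', ← integral_sub (integrable_mul_abs_rpow hg hC hc s)
      (integrable_mul_abs_rpow hg hC hc s₀),
      intervalIntegral_integral_swap (integrable_prod_mul_kernel hg hC hc s₀ s),
      ← integral_const_mul, ← integral_neg]
    refine integral_congr_ae (Eventually.of_forall fun y => ?_)
    simp only
    rw [← mul_sub, abs_rpow_sub_abs_rpow hc, intervalIntegral.integral_const_mul]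
    ring
  rw [funext key]
  exact (((hcont.integral_hasStrictDerivAt s₀ s₀).hasDerivAt.const_mul c).neg).const_add _

lemma integral_eq_zero_of_hasDerivAt_off_countable {f f' : ℝ → ℝ} {s : Set ℝ} (hs : s.Countable)
    (hf : Continuous f) (hd : ∀ y ∉ s, HasDerivAt f (f' y) y) (hi : Integrable f')
    (hbot : Tendsto f atBot (𝓝 0)) (htop : Tendsto f atTop (𝓝 0)) : ∫ y, f' y = 0 := by
  have h1 := intervalIntegral_tendsto_integral hi tendsto_neg_atTop_atBot tendsto_id
  have h2 : Tendsto (fun r => f r - f (-r)) atTop (𝓝 (0 - 0)) :=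
    htop.sub (hbot.comp tendsto_neg_atTop_atBot)
  rw [sub_zero] at h2
  refine tendsto_nhds_unique (h1.congr fun r => ?_) h2
  exact integral_eq_of_hasDerivAt_off_countable f f' hs hf.continuousOn
    (fun y hy => hd y hy.2) hi.intervalIntegrable

end Analysis

section Weight

open Real Filter Topology

variable {N : ℕ}

/-- The Gaussian weight with algebraic singularities of order `γ k` at `t k`, for `k ∈ s`. -/
noncomputable def singularWeight (s : Finset (Fin N)) (γ t : Fin N → ℝ) (y : ℝ) : ℝ :=
  exp (-y ^ 2) * ∏ k ∈ s, |y - t k| ^ γ k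

variable {γ : Fin N → ℝ}

lemma singularWeight_univ_eq (γ t : Fin N → ℝ) (j : Fin N) (y : ℝ) :
    singularWeight Finset.univ γ t y =
      singularWeight (Finset.univ.erase j) γ t y * |y - t j| ^ γ j := by
  rw [singularWeight, singularWeight, mul_assoc, Finset.prod_erase_mul _ _ (Finset.mem_univ j)]

lemma continuous_eval_mul_singularWeight (hγ : ∀ j, 0 < γ j) (s : Finset (Fin N))
    (t : Fin N → ℝ) (q : ℝ[X]) : Continuous fun y => q.eval y * singularWeight s γ t y :=
  q.continuous.mul ((by fun_prop : Continuous fun y : ℝ => exp (-y ^ 2)).mul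
    (continuous_finsetProd _ fun k _ => continuous_abs_sub_rpow (hγ k) (t k)))

lemma eval_mul_singularWeight_le (hγ : ∀ j, 0 < γ j) (s : Finset (Fin N)) (t : Fin N → ℝ)
    (q : ℝ[X]) :
    ∃ C, ∀ y, |q.eval y * singularWeight s γ t y| ≤ C * exp (-(1 / 2) * y ^ 2) := by
  have h1 : SubGaussianGrowth fun y => ∏ k ∈ s, |y - t k| ^ γ k :=
    .prod s fun k => (SubGaussianGrowth.id.add (.const (-t k))).abs_rpow (hγ k)
  have h2 := ((SubGaussianGrowth.eval q).mul h1).exp_bound (g := fun y => exp (-y ^ 2))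
    (a := 1) (b := 1 / 2) (by norm_num) ⟨1, fun y => by simp⟩
  simpa only [singularWeight, mul_assoc, mul_comm, mul_left_comm] using h2

lemma integrable_eval_mul_singularWeight (hγ : ∀ j, 0 < γ j) (s : Finset (Fin N))
    (t : Fin N → ℝ) (q : ℝ[X]) : Integrable fun y => q.eval y * singularWeight s γ t y :=
  integrable_of_le_gaussian (continuous_eval_mul_singularWeight hγ s t q)
    (by norm_num : (0 : ℝ) < 1 / 2) (eval_mul_singularWeight_le hγ s t q)

lemma eval_mul_singularWeight_div (γ t : Fin N → ℝ) (j : Fin N) (q : ℝ[X]) (y : ℝ) :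
    q.eval y * singularWeight Finset.univ γ t y / (y - t j) =
      q.eval y * singularWeight (Finset.univ.erase j) γ t y *
        (|y - t j| ^ γ j / (y - t j)) := by
  rw [singularWeight_univ_eq γ t j]; ring

lemma integrable_eval_mul_singularWeight_div (hγ : ∀ j, 0 < γ j) (t : Fin N → ℝ) (j : Fin N)
    (q : ℝ[X]) :
    Integrable fun y => q.eval y * singularWeight Finset.univ γ t y / (y - t j) := by
  simp_rw [eval_mul_singularWeight_div]
  exact integrable_mul_kernel (continuous_eval_mul_singularWeight hγ _ t q)
    (eval_mul_singularWeight_le hγ _ t q) (hγ j) (t j)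

/-- Integration of a polynomial against the singular Gaussian weight. -/
noncomputable def momentForm (hγ : ∀ j, 0 < γ j) (t : Fin N → ℝ) : ℝ[X] →ₗ[ℝ] ℝ where
  toFun q := ∫ y, q.eval y * singularWeight Finset.univ γ t y
  map_add' p q := by
    rw [← integral_add (integrable_eval_mul_singularWeight hγ _ t p)
      (integrable_eval_mul_singularWeight hγ _ t q)]
    simp only [eval_add, add_mul]
  map_smul' c q := by
    simp only [eval_smul, smul_eq_mul, mul_assoc, RingHom.id_apply]
    rw [integral_const_mul]

/-- Integration of a polynomial against the singular Gaussian weight divided by `y - t j`,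
multiplied by `γ j`. -/
noncomputable def poleForm (hγ : ∀ j, 0 < γ j) (t : Fin N → ℝ) (j : Fin N) : ℝ[X] →ₗ[ℝ] ℝ where
  toFun q := γ j * ∫ y, q.eval y * singularWeight Finset.univ γ t y / (y - t j)
  map_add' p q := by
    rw [← mul_add, ← integral_add (integrable_eval_mul_singularWeight_div hγ t j p)
      (integrable_eval_mul_singularWeight_div hγ t j q)]
    simp only [eval_add, add_mul, add_div]
  map_smul' c q := by
    simp only [eval_smul, smul_eq_mul, mul_assoc, mul_div_assoc, RingHom.id_apply]
    rw [integral_const_mul, mul_left_comm]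

lemma momentForm_apply (hγ : ∀ j, 0 < γ j) (t : Fin N → ℝ) (q : ℝ[X]) :
    momentForm hγ t q = ∫ y, q.eval y * singularWeight Finset.univ γ t y := rfl

lemma poleForm_apply (hγ : ∀ j, 0 < γ j) (t : Fin N → ℝ) (j : Fin N) (q : ℝ[X]) :
    poleForm hγ t j q =
      γ j * ∫ y, q.eval y * singularWeight Finset.univ γ t y / (y - t j) := rfl

lemma poleForm_X_sub_C_mul (hγ : ∀ j, 0 < γ j) (t : Fin N → ℝ) (j : Fin N) (q : ℝ[X]) :
    poleForm hγ t j ((X - C (t j)) * q) = γ j * momentForm hγ t q := by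
  rw [poleForm_apply, momentForm_apply]
  congr 1
  refine integral_congr_ae ?_
  filter_upwards [compl_mem_ae_iff.2 (measure_singleton (t j))] with y hy
  have : y - t j ≠ 0 := sub_ne_zero.2 hy
  simp only [eval_mul, eval_sub, eval_X, eval_C]
  field_simp

lemma poleForm_X_mul (hγ : ∀ j, 0 < γ j) (t : Fin N → ℝ) (j : Fin N) (q : ℝ[X]) :
    poleForm hγ t j (X * q) = t j * poleForm hγ t j q + γ j * momentForm hγ t q := by
  have e : X * q = t j • q + (X - C (t j)) * q := by rw [smul_eq_C_mul]; ring
  rw [e, map_add, map_smul, poleForm_X_sub_C_mul, smul_eq_mul]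

lemma hasDerivAt_singularWeight (γ t : Fin N → ℝ) {y : ℝ} (hy : ∀ j, y - t j ≠ 0) :
    HasDerivAt (singularWeight Finset.univ γ t)
      (-(2 * y) * singularWeight Finset.univ γ t y +
        ∑ j, γ j * (singularWeight Finset.univ γ t y / (y - t j))) y := by
  have h1 : HasDerivAt (fun y : ℝ => exp (-y ^ 2)) (exp (-y ^ 2) * -(2 * y)) y := by
    simpa using ((hasDerivAt_pow 2 y).neg).exp
  have h2 := HasDerivAt.fun_finsetProd (u := Finset.univ) (f := fun j y => |y - t j| ^ γ j)
    (x := y) fun j _ => (hasDerivAt_abs_rpow_of_ne_zero (hy j) (γ j)).comp_sub_const y (t j)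
  refine (h1.mul h2).congr_deriv ?_
  rw [Finset.mul_sum]
  congr 1
  · rw [singularWeight]; ring
  · refine Finset.sum_congr rfl fun j _ => ?_
    rw [singularWeight_univ_eq γ t j, singularWeight, smul_eq_mul]
    ring

/-- Integration by parts against the singular Gaussian weight. -/
lemma momentForm_derivative (hγ : ∀ j, 0 < γ j) (t : Fin N → ℝ) (q : ℝ[X]) :
    momentForm hγ t (derivative q) - 2 * momentForm hγ t (X * q) + ∑ j, poleForm hγ t j q =
      0 := by
  have i1 := integrable_eval_mul_singularWeight hγ Finset.univ t (derivative q)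
  have i2 := (integrable_eval_mul_singularWeight hγ Finset.univ t (X * q)).const_mul 2
  have i3 := fun j => (integrable_eval_mul_singularWeight_div hγ t j q).const_mul (γ j)
  have i12 : Integrable fun y => (derivative q).eval y * singularWeight Finset.univ γ t y -
      2 * ((X * q).eval y * singularWeight Finset.univ γ t y) := i1.sub i2
  have i4 := integrable_finsetSum Finset.univ fun j _ => i3 j
  simp only [momentForm_apply, poleForm_apply, ← integral_const_mul]
  rw [← integral_finsetSum _ fun j _ => i3 j, ← integral_sub i1 i2,
    ← integral_add i12 i4]
  have hb := eval_mul_singularWeight_le hγ Finset.univ t q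
  refine integral_eq_zero_of_hasDerivAt_off_countable (s := Set.range t)
    (Set.countable_range t) (continuous_eval_mul_singularWeight hγ Finset.univ t q) ?_
    (i12.add i4)
    (tendsto_zero_of_le_gaussian (by norm_num) hb ?_)
    (tendsto_zero_of_le_gaussian (by norm_num) hb (tendsto_pow_atTop two_ne_zero))
  · intro y hy
    have hy' : ∀ j, y - t j ≠ 0 := fun j e => hy ⟨j, (sub_eq_zero.1 e).symm⟩
    refine ((q.hasDerivAt y).mul (hasDerivAt_singularWeight γ t hy')).congr_deriv ?_
    rw [mul_add, Finset.mul_sum, ← add_assoc]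
    congr 1
    · simp only [eval_mul, eval_X]; ring
    · exact Finset.sum_congr rfl fun j _ => by ring
  · simpa [Function.comp_def] using
      (tendsto_pow_atTop (α := ℝ) two_ne_zero).comp tendsto_neg_atBot_atTop

lemma hasDerivAt_momentForm_update (hγ : ∀ j, 0 < γ j) (t : Fin N → ℝ) (j : Fin N) (q : ℝ[X]) :
    HasDerivAt (fun s => momentForm hγ (Function.update t j s) q) (-poleForm hγ t j q) (t j) := by
  have h := hasDerivAt_integral_mul_abs_rpow
    (continuous_eval_mul_singularWeight hγ (Finset.univ.erase j) t q)
    (eval_mul_singularWeight_le hγ _ t q) (hγ j) (t j)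
  simp only [momentForm_apply, poleForm_apply, eval_mul_singularWeight_div]
  refine h.congr_of_eventuallyEq (Eventually.of_forall fun s => ?_)
  refine integral_congr_ae (Eventually.of_forall fun y => ?_)
  have : singularWeight (Finset.univ.erase j) γ (Function.update t j s) y =
      singularWeight (Finset.univ.erase j) γ t y := by
    rw [singularWeight, singularWeight]
    congr 1
    refine Finset.prod_congr rfl fun k hk => ?_
    rw [Function.update_of_ne (Finset.ne_of_mem_erase hk)]
  simp only [singularWeight_univ_eq γ _ j, this, Function.update_self, mul_assoc]

lemma hasDerivAt_momentForm_mul (hγ : ∀ j, 0 < γ j) (t : Fin N → ℝ) (j : Fin N)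
    {A : ℝ → ℝ[X]} {n : ℕ} {c' : ℕ → ℝ}
    (hA : ∀ᶠ s in 𝓝 (t j), (A s).Monic ∧ (A s).natDegree = n)
    (hc : ∀ k, HasDerivAt (fun s => (A s).coeff k) (c' k) (t j)) (Q : ℝ[X]) :
    HasDerivAt (fun s => momentForm hγ (Function.update t j s) (A s * Q))
      (momentForm hγ t (Q * ∑ k ∈ Finset.range n, C (c' k) * X ^ k) -
        poleForm hγ t j (A (t j) * Q)) (t j) := by
  have hsum : ∀ B : ℝ[X], B.Monic ∧ B.natDegree = n → B * Q =
      X ^ n * Q + ∑ k ∈ Finset.range n, B.coeff k • (X ^ k * Q) := by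
    rintro B ⟨hB, hn⟩
    conv_lhs => rw [hB.as_sum, hn]
    rw [add_mul, Finset.sum_mul]
    simp only [smul_eq_C_mul, mul_assoc]
  have h1 : (fun s => momentForm hγ (Function.update t j s) (A s * Q)) =ᶠ[𝓝 (t j)]
      fun s => momentForm hγ (Function.update t j s) (X ^ n * Q) + ∑ k ∈ Finset.range n,
        (A s).coeff k * momentForm hγ (Function.update t j s) (X ^ k * Q) := by
    filter_upwards [hA] with s hs
    rw [hsum _ hs, map_add, map_sum]
    simp only [map_smul, smul_eq_mul]
  have h2 := (hasDerivAt_momentForm_update hγ t j (X ^ n * Q)).add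
    (HasDerivAt.fun_sum (u := Finset.range n) fun k _ =>
      (hc k).mul (hasDerivAt_momentForm_update hγ t j (X ^ k * Q)))
  refine (h2.congr_of_eventuallyEq h1).congr_deriv ?_
  rw [hsum _ hA.self_of_nhds, Finset.mul_sum]
  simp only [map_add, map_sum, map_smul, smul_eq_mul, Function.update_eq_self,
    Finset.sum_add_distrib]
  have e : ∀ k, momentForm hγ t (Q * (C (c' k) * X ^ k)) =
      c' k * momentForm hγ t (X ^ k * Q) := fun k => by
    have e' : Q * (C (c' k) * X ^ k) = c' k • (X ^ k * Q) := by rw [smul_eq_C_mul]; ring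
    rw [e', map_smul, smul_eq_mul]
  simp only [e, mul_neg, Finset.sum_neg_distrib]
  ring

end Weight


theorem sigma_in_aux
    (N : ℕ) (hN : 1 ≤ N) (γ : Fin N → ℝ) (hγ : ∀ j, 0 < γ j)
    (U : Set (Fin N → ℝ)) (hU : IsOpen U) (hUinj : ∀ x ∈ U, Function.Injective x)
    (w : (Fin N → ℝ) → ℝ → ℝ)
    (hw : ∀ x ∈ U, ∀ y : ℝ, w x y = Real.exp (-y ^ 2) * ∏ j, |y - x j| ^ γ j)
    (P : ℕ → (Fin N → ℝ) → Polynomial ℝ)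
    (hPmonic : ∀ n, ∀ x ∈ U, (P n x).Monic) (hPdeg : ∀ n, ∀ x ∈ U, (P n x).natDegree = n)
    (horth : ∀ m n, m ≠ n → ∀ x ∈ U, ∫ y : ℝ, (P m x).eval y * (P n x).eval y * w x y = 0)
    (h : ℕ → (Fin N → ℝ) → ℝ)
    (hh : ∀ n, ∀ x ∈ U, h n x = ∫ y : ℝ, ((P n x).eval y) ^ 2 * w x y)
    (hhpos : ∀ n, ∀ x ∈ U, 0 < h n x)
    (β : ℕ → (Fin N → ℝ) → ℝ) (hβ0 : ∀ x ∈ U, β 0 x = 0)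
    (hβ : ∀ n, ∀ x ∈ U, β (n + 1) x = h (n + 1) x / h n x)
    (α : ℕ → (Fin N → ℝ) → ℝ)
    (hα : ∀ n, ∀ x ∈ U, α n x = (∫ y : ℝ, y * ((P n x).eval y) ^ 2 * w x y) / h n x)
    (p : ℕ → (Fin N → ℝ) → ℝ) (hp0 : ∀ x ∈ U, p 0 x = 0)
    (hp : ∀ n, ∀ x ∈ U, p (n + 1) x = (P (n + 1) x).coeff n)
    (R : ℕ → Fin N → (Fin N → ℝ) → ℝ)
    (hR : ∀ n j, ∀ x ∈ U, R n j x = γ j / h n x * ∫ y : ℝ, ((P n x).eval y) ^ 2 * w x y / (y - x j))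
    (r : ℕ → Fin N → (Fin N → ℝ) → ℝ) (hr0 : ∀ j, ∀ x ∈ U, r 0 j x = 0)
    (hr : ∀ n j, ∀ x ∈ U, r (n + 1) j x = γ j / h n x * ∫ y : ℝ, (P (n + 1) x).eval y * (P n x).eval y * w x y / (y - x j))
    (hPC2 : ∀ m k, ContDiffOn ℝ 2 (fun x => (P m x).coeff k) U)
    (hhC2 : ∀ m, ContDiffOn ℝ 2 (h m) U)
    (hαC2 : ∀ m, ContDiffOn ℝ 2 (α m) U)
    (hβC2 : ∀ m, ContDiffOn ℝ 2 (β m) U)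
    (hpC2 : ∀ m, ContDiffOn ℝ 2 (p m) U)
    (hRC2 : ∀ m j, ContDiffOn ℝ 2 (R m j) U)
    (hrC2 : ∀ m j, ContDiffOn ℝ 2 (r m j) U)
    (σ : ℕ → (Fin N → ℝ) → ℝ)
    (hσ : ∀ n, ∀ x ∈ U, σ n x = ∑ k, pd k (fun y => Real.log (∏ i ∈ Finset.range n, h i y)) x)
    (n : ℕ) (hn : 1 ≤ n) (x : Fin N → ℝ) (hx : x ∈ U) (hRne : ∀ j, R n j x ≠ 0) :
    σ n x = 2 * p n x ∧
      σ n x = 2 * (∑ j, x j * r n j x) - (((n : ℝ) + ∑ j, r n j x) * (∑ j, R n j x))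
        - 2 * ∑ j, ((r n j x) ^ 2 - γ j * r n j x) / R n j x ∧
      ∀ j, pd j (σ n) x = 2 * r n j x := by
  set I := fun t => momentForm hγ t with hI_def
  set J := fun t j => poleForm hγ t j with hJ_def
  have hw' : ∀ t ∈ U, ∀ y, w t y = singularWeight Finset.univ γ t y := fun t ht y => by
    rw [hw t ht, singularWeight]
  have hortho : ∀ t ∈ U, ∀ m n, m ≠ n → I t (P m t * P n t) = 0 := fun t ht m n hmn => by
    simp only [hI_def, momentForm_apply, eval_mul, ← hw' t ht]
    exact horth m n hmn t ht
  have hhI : ∀ t ∈ U, ∀ n, I t (P n t * P n t) = h n t := fun t ht n => by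
    simp only [hI_def, momentForm_apply, eval_mul, ← hw' t ht, hh n t ht, sq]
  have hRJ : ∀ t ∈ U, ∀ n j, J t j (P n t * P n t) = R n j t * h n t := fun t ht n j => by
    have := (hhpos n t ht).ne'
    simp only [hJ_def, poleForm_apply, eval_mul, ← hw' t ht, hR n j t ht, sq]
    field_simp
  have hrJ : ∀ t ∈ U, ∀ n j, J t j (P (n + 1) t * P n t) = r (n + 1) j t * h n t :=
    fun t ht n j => by
      have := (hhpos n t ht).ne'
      simp only [hJ_def, poleForm_apply, eval_mul, ← hw' t ht, hr n j t ht]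
      field_simp
  have hpX : ∀ t ∈ U, ∀ n, (X * P n t).coeff n = p n t := fun t ht n => by
    cases n with
    | zero => simp [hp0 t ht]
    | succ n => rw [coeff_X_mul, hp n t ht]
  have hmon := fun t (ht : t ∈ U) n => hPmonic n t ht
  have hdeg := fun t (ht : t ∈ U) n => hPdeg n t ht
  have hnear : ∀ t ∈ U, ∀ j, ∀ᶠ s in nhds (t j), Function.update t j s ∈ U := fun t ht j =>
    (hasDerivAt_update t j (t j)).continuousAt.eventually_mem
      (by rw [Function.update_eq_self]; exact hU.mem_nhds ht)
  have hcoeff : ∀ t ∈ U, ∀ n j k, HasDerivAt (fun s => (P n (Function.update t j s)).coeff k)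
      (pd j (fun y => (P n y).coeff k) t) (t j) := fun t ht n j k => by
    have h1 : DifferentiableAt ℝ (fun y => (P n y).coeff k) (Function.update t j (t j)) := by
      rw [Function.update_eq_self]
      exact ((hPC2 n k).contDiffAt (hU.mem_nhds ht)).differentiableAt two_ne_zero
    exact (h1.comp (t j) (hasDerivAt_update t j (t j)).differentiableAt).hasDerivAt
  have hderiv : ∀ t ∈ U, ∀ n j (Q : ℝ[X]),
      HasDerivAt (fun s => I (Function.update t j s) (P n (Function.update t j s) * Q))
        (I t (Q * ∑ k ∈ Finset.range n, C (pd j (fun y => (P n y).coeff k) t) * X ^ k) -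
          J t j (P n t * Q)) (t j) := fun t ht n j Q => by
    have := hasDerivAt_momentForm_mul hγ t j (A := fun s => P n (Function.update t j s))
      ((hnear t ht j).mono fun s hs => ⟨hPmonic n _ hs, hPdeg n _ hs⟩)
      (fun k => hcoeff t ht n j k) Q
    simpa only [Function.update_eq_self] using this
  have hdeg_sum : ∀ (n : ℕ) (c : ℕ → ℝ),
      (∑ k ∈ Finset.range n, C (c k) * X ^ k).degree < (n : WithBot ℕ) :=
    fun n c => (degree_lt_iff_coeff_zero _ _).2 fun m hm => by
      simp only [finsetSum_coeff, coeff_C_mul_X_pow]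
      exact Finset.sum_eq_zero fun k hk => if_neg (by have := Finset.mem_range.1 hk; omega)
  have hdh : ∀ t ∈ U, ∀ n j, HasDerivAt (fun s => h n (Function.update t j s))
      (-(R n j t * h n t)) (t j) := fun t ht n j => by
    have h1 := hderiv t ht n j (P n t)
    rw [pairing_eq_zero (hmon t ht) (hdeg t ht) (hortho t ht) (hdeg_sum n _), zero_sub,
      hRJ t ht] at h1
    refine h1.congr_of_eventuallyEq ((hnear t ht j).mono fun s hs => ?_)
    simp only
    rw [pairing_eq (hmon _ hs) (hdeg _ hs) (hortho _ hs) (hdeg t ht n).le,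
      coeff_self_eq_one (hmon t ht) (hdeg t ht), one_mul, hhI _ hs]
  have hdp : ∀ t ∈ U, ∀ n j, HasDerivAt (fun s => p (n + 1) (Function.update t j s))
      (r (n + 1) j t) (t j) := fun t ht n j => by
    have h1 := hderiv t ht (n + 1) j (P n t)
    have h2 : HasDerivAt (fun s => I (Function.update t j s)
        (P (n + 1) (Function.update t j s) * P n t)) 0 (t j) :=
      (hasDerivAt_const (t j) (0 : ℝ)).congr_of_eventuallyEq
        ((hnear t ht j).mono fun s hs => pairing_eq_zero (hmon _ hs) (hdeg _ hs) (hortho _ hs)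
          (by
            rw [degree_eq_natDegree (hmon t ht n).ne_zero, hdeg t ht]
            exact_mod_cast n.lt_succ_self))
    have h3 := h1.unique h2
    rw [pairing_eq (hmon t ht) (hdeg t ht) (hortho t ht)
      (natDegree_le_iff_coeff_eq_zero.2 ((degree_lt_iff_coeff_zero _ _).1 (hdeg_sum (n + 1) _))),
      hhI t ht, hrJ t ht, ← sub_mul] at h3
    have h4 := (mul_eq_zero.1 h3).resolve_right (hhpos n t ht).ne'
    simp only [finsetSum_coeff, coeff_C_mul_X_pow, Finset.sum_ite_eq, Finset.mem_range,
      Nat.lt_succ_self, if_true, sub_eq_zero] at h4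
    rw [← h4]
    exact (hcoeff t ht (n + 1) j n).congr_of_eventuallyEq
      ((hnear t ht j).mono fun s hs => hp n _ hs)
  have hsumR : ∀ t ∈ U, ∀ n, ∑ j, R n j t = 2 * (p n t - p (n + 1) t) := fun t ht n => by
    have h1 := momentForm_derivative hγ t (P n t * P n t)
    have h2 := pairing_derivative_self (hmon t ht) (hdeg t ht) (hortho t ht) n
    have h3 := pairing_X_mul_self (hmon t ht) (hdeg t ht) (hortho t ht) n
    have h4 := Finset.sum_congr rfl fun j (_ : j ∈ Finset.univ) => hRJ t ht n j
    simp only [hI_def, hJ_def] at h2 h3 h4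
    have h5 := hhI t ht n
    simp only [hI_def] at h5
    rw [h2, h3, h4, ← Finset.sum_mul, h5, hpX t ht, hpX t ht] at h1
    refine mul_right_cancel₀ (hhpos n t ht).ne' ?_
    linarith
  have hσp : ∀ t ∈ U, ∀ n, σ n t = 2 * p n t := fun t ht n => by
    have h1 : ∀ k, pd k (fun y => Real.log (∏ i ∈ Finset.range n, h i y)) t =
        -∑ i ∈ Finset.range n, R i k t := fun k => by
      have h2 := HasDerivAt.fun_sum (u := Finset.range n) fun i _ =>
        (hdh t ht i k).log (by rw [Function.update_eq_self]; exact (hhpos i t ht).ne')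
      have h3 := h2.congr_of_eventuallyEq ((hnear t ht k).mono fun s hs =>
        Real.log_prod (s := Finset.range n) fun i _ => (hhpos i _ hs).ne')
      rw [pd, h3.deriv, ← Finset.sum_neg_distrib]
      refine Finset.sum_congr rfl fun i _ => ?_
      rw [Function.update_eq_self, neg_div, mul_div_cancel_right₀ _ (hhpos i t ht).ne']
    rw [hσ n t ht, Finset.sum_congr rfl fun k _ => h1 k, Finset.sum_neg_distrib,
      Finset.sum_comm, Finset.sum_congr rfl fun i _ => hsumR t ht i, ← Finset.mul_sum,
      Finset.sum_range_sub', hp0 t ht]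
    ring
  refine ⟨hσp x hx n, ?_, fun j => ?_⟩
  · obtain ⟨m, rfl⟩ : ∃ m, n = m + 1 := ⟨n - 1, by omega⟩
    have hm := hmon x hx
    have hd := hdeg x hx
    have ho := hortho x hx
    have hI0 := (hhpos m x hx).ne'
    have hI1 := (hhpos (m + 1) x hx).ne'
    have hsumr : ((m : ℝ) + 1 + ∑ j, r (m + 1) j x) * h m x = 2 * h (m + 1) x := by
      have h1 : I x _ - 2 * I x _ + ∑ j, J x j _ = 0 :=
        momentForm_derivative hγ x (P (m + 1) x * P m x)
      rw [pairing_derivative_succ hm hd ho, pairing_X_mul_succ hm hd ho,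
        Finset.sum_congr rfl fun j _ => hrJ x hx m j, ← Finset.sum_mul, hhI x hx,
        hhI x hx] at h1
      linarith
    have hsumtr : (∑ j, x j * r (m + 1) j x) * h m x =
        p (m + 1) x * h m x + 2 * (p m x - p (m + 2) x) * h (m + 1) x := by
      have h1 : I x _ - 2 * I x _ + ∑ j, J x j _ = 0 :=
        momentForm_derivative hγ x (X * (P (m + 1) x * P m x))
      have h2 : ∀ j, J x j (X * (P (m + 1) x * P m x)) = x j * r (m + 1) j x * h m x :=
        fun j => by
          have h3 : J x j (X * (P (m + 1) x * P m x)) =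
            x j * J x j (P (m + 1) x * P m x) + γ j * I x (P (m + 1) x * P m x) :=
            poleForm_X_mul hγ x j _
          rw [h3, hrJ x hx, ho _ _ (by omega)]
          ring
      rw [pairing_derivative_X_mul_succ hm hd ho, pairing_X_sq_mul_succ hm hd ho,
        Finset.sum_congr rfl fun j _ => h2 j, ← Finset.sum_mul, hhI x hx, hhI x hx, hpX x hx,
        hpX x hx, hpX x hx] at h1
      linarith
    have hquot : ∀ j, ((r (m + 1) j x) ^ 2 - γ j * r (m + 1) j x) / R (m + 1) j x =
        h (m + 1) x / h m x * R m j x := fun j => by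
      have h1 := ladder_product_eq (J := J x j) (poleForm_X_sub_C_mul hγ x j) hm hd ho m
      have h2 : momentForm hγ x (P m x * P m x) = h m x := hhI x hx m
      rw [hrJ x hx, hRJ x hx, hRJ x hx, h2] at h1
      rw [div_eq_iff (hRne j)]
      field_simp
      refine mul_right_cancel₀ hI0 ?_
      linear_combination h1
    rw [hσp x hx, Finset.sum_congr rfl fun j _ => hquot j, ← Finset.mul_sum, hsumR x hx,
      hsumR x hx]
    have e1 := eq_div_of_mul_eq hI0 hsumr
    have e2 := eq_div_of_mul_eq hI0 hsumtr
    push_cast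
    rw [e1, e2]
    field_simp
    ring
  · obtain ⟨m, rfl⟩ : ∃ m, n = m + 1 := ⟨n - 1, by omega⟩
    exact (((hdp x hx m j).const_mul 2).congr_of_eventuallyEq
      ((hnear x hx j).mono fun s hs => hσp _ hs (m + 1))).deriv
end

section
/- (Theorem 5.1, part 2: R_{n,j} in terms of σ_n.) For every integer n ≥ 1, every index 1 ≤ j ≤ N and every t ∈ U with R_{n,j}(t) ≠ 0 for all j, set Δ_j(t) = (∂_j²σ_n + Σ_{k≠j} ∂_k∂_jσ_n)²(t) + 4·(2n + δσ_n(t))·∂_jσ_n(t)·(∂_jσ_n(t) − 2γ_j). Then Δ_j(t) ≥ 0, 2n + δσ_n(t) = 4β_n(t) > 0, and R_{n,j}(t) = [−(∂_j²σ_n + Σ_{k≠j} ∂_k∂_jσ_n)(t) + sgn(R_{n,j}(t) + R_{n−1,j}(t))·√(Δ_j(t))] / (2·(2n + δσ_n(t))), where sgn(u) = 1 for u > 0, −1 for u < 0 and 0 for u = 0. -/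
open MeasureTheory Polynomial

/-- A continuous function of at most exponential growth. -/
structure ExpGrowth (f : ℝ → ℝ) : Prop where
  continuous : Continuous f
  bound : ∃ C b : ℝ, ∀ y, |f y| ≤ C * Real.exp (b * |y|)

namespace ExpGrowth

theorem const (c : ℝ) : ExpGrowth fun _ => c :=
  ⟨continuous_const, |c|, 0, fun y => by simp⟩

theorem id : ExpGrowth fun y => y :=
  ⟨continuous_id, 1, 1, fun y => by
    have := Real.add_one_le_exp |y|
    rw [one_mul, one_mul]
    linarith⟩

theorem mul {f g : ℝ → ℝ} (hf : ExpGrowth f) (hg : ExpGrowth g) :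
    ExpGrowth fun y => f y * g y := by
  obtain ⟨hfc, C, b, hC⟩ := hf
  obtain ⟨hgc, D, d, hD⟩ := hg
  refine ⟨hfc.mul hgc, C * D, b + d, fun y => ?_⟩
  rw [abs_mul, add_mul, Real.exp_add, mul_mul_mul_comm]
  exact mul_le_mul (hC y) (hD y) (abs_nonneg _) ((abs_nonneg _).trans (hC y))

theorem add {f g : ℝ → ℝ} (hf : ExpGrowth f) (hg : ExpGrowth g) :
    ExpGrowth fun y => f y + g y := by
  obtain ⟨hfc, C, b, hC⟩ := hf
  obtain ⟨hgc, D, d, hD⟩ := hg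
  refine ⟨hfc.add hgc, |C| + |D|, max b d, fun y => ?_⟩
  have h1 : |f y| ≤ |C| * Real.exp (max b d * |y|) :=
    (hC y).trans <| mul_le_mul (le_abs_self C)
      (Real.exp_le_exp.2 <| mul_le_mul_of_nonneg_right (le_max_left _ _) (abs_nonneg _))
      (Real.exp_pos _).le (abs_nonneg _)
  have h2 : |g y| ≤ |D| * Real.exp (max b d * |y|) :=
    (hD y).trans <| mul_le_mul (le_abs_self D)
      (Real.exp_le_exp.2 <| mul_le_mul_of_nonneg_right (le_max_right _ _) (abs_nonneg _))
      (Real.exp_pos _).le (abs_nonneg _)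
  rw [add_mul]
  exact (abs_add_le _ _).trans (add_le_add h1 h2)

theorem pow {f : ℝ → ℝ} (hf : ExpGrowth f) (n : ℕ) : ExpGrowth fun y => f y ^ n := by
  induction n with
  | zero => simpa using const 1
  | succ n ih => simpa only [pow_succ] using ih.mul hf

theorem prod {ι : Type*} (s : Finset ι) {f : ι → ℝ → ℝ} (hf : ∀ i ∈ s, ExpGrowth (f i)) :
    ExpGrowth fun y => ∏ i ∈ s, f i y := by
  classical
  induction s using Finset.induction_on with
  | empty => simpa using const 1
  | insert i s hi ih =>
    simp only [Finset.prod_insert hi]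
    exact (hf i (Finset.mem_insert_self i s)).mul
      (ih fun k hk => hf k (Finset.mem_insert_of_mem hk))

theorem polynomial (F : ℝ[X]) : ExpGrowth fun y => F.eval y := by
  induction F using Polynomial.induction_on' with
  | add p q hp hq => simpa only [eval_add] using hp.add hq
  | monomial n a => simpa only [eval_monomial] using (const a).mul (id.pow n)

theorem exp_abs_sub {c : ℝ} (hc : 0 ≤ c) (t : ℝ) :
    ExpGrowth fun y => Real.exp (c * |y - t|) := by
  refine ⟨by fun_prop, Real.exp (c * |t|), c, fun y => ?_⟩
  rw [Real.abs_exp, ← Real.exp_add, Real.exp_le_exp, ← mul_add, add_comm]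
  exact mul_le_mul_of_nonneg_left (abs_sub y t) hc

theorem abs_sub_rpow {c : ℝ} (hc : 0 ≤ c) (t : ℝ) : ExpGrowth fun y => |y - t| ^ c := by
  obtain ⟨-, C, b, h⟩ := exp_abs_sub hc t
  refine ⟨(continuous_abs.comp (continuous_id.sub continuous_const)).rpow_const
    fun _ => Or.inr hc, C, b, fun y => le_trans ?_ (h y)⟩
  rw [Real.abs_exp, Real.abs_rpow_of_nonneg (abs_nonneg _), abs_abs, mul_comm, Real.exp_mul]
  exact Real.rpow_le_rpow (abs_nonneg _)
    (by linarith [Real.add_one_le_exp |y - t|]) hc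

theorem exists_le_exp_neg_half_sq {f : ℝ → ℝ} (hf : ExpGrowth f) :
    ∃ C, ∀ y, |f y * Real.exp (-y ^ 2)| ≤ C * Real.exp (-(1 / 2) * y ^ 2) := by
  obtain ⟨-, C, b, h⟩ := hf
  have hC : 0 ≤ C := by simpa using (abs_nonneg _).trans (h 0)
  refine ⟨C * Real.exp (b ^ 2 / 2), fun y => ?_⟩
  rw [abs_mul, Real.abs_exp]
  calc |f y| * Real.exp (-y ^ 2) ≤ C * Real.exp (b * |y|) * Real.exp (-y ^ 2) :=
        mul_le_mul_of_nonneg_right (h y) (Real.exp_pos _).le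
    _ = C * Real.exp (b * |y| + -y ^ 2) := by rw [mul_assoc, ← Real.exp_add]
    _ ≤ C * Real.exp (b ^ 2 / 2 + -(1 / 2) * y ^ 2) := by
        refine mul_le_mul_of_nonneg_left (Real.exp_le_exp.2 ?_) hC
        nlinarith [sq_nonneg (|y| - b), sq_abs y]
    _ = _ := by rw [Real.exp_add, mul_assoc]

theorem tendsto_mul_exp_neg_sq {f : ℝ → ℝ} (hf : ExpGrowth f) :
    Filter.Tendsto (fun y => f y * Real.exp (-y ^ 2)) (Filter.cocompact ℝ) (nhds 0) := by
  obtain ⟨C, h⟩ := hf.exists_le_exp_neg_half_sq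
  refine squeeze_zero_norm h ?_
  have : Filter.Tendsto (fun y : ℝ => y ^ 2) (Filter.cocompact ℝ) Filter.atTop := by
    simpa only [Function.comp_def, Real.norm_eq_abs, sq_abs] using
      (Filter.tendsto_pow_atTop two_ne_zero).comp (tendsto_norm_cocompact_atTop (E := ℝ))
  simpa using ((Real.tendsto_exp_atBot.comp
    (this.const_mul_atTop_of_neg (show -(1 / 2 : ℝ) < 0 by norm_num))).const_mul C)

end ExpGrowth

theorem integrable_abs_rpow_mul_exp_neg_mul_sq {b : ℝ} (hb : 0 < b) {s : ℝ} (hs : -1 < s) :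
    Integrable fun x : ℝ => |x| ^ s * Real.exp (-b * x ^ 2) := by
  have := (integrable_fun_norm_addHaar (volume : Measure ℝ)
    (f := fun r : ℝ => r ^ s * Real.exp (-b * r ^ 2))).2
      (by simpa using integrableOn_rpow_mul_exp_neg_mul_sq hb hs)
  simpa using this

theorem ExpGrowth.integrable {f : ℝ → ℝ} (hf : ExpGrowth f) (t : ℝ) {s : ℝ} (hs : -1 < s) :
    Integrable fun y : ℝ => f y * Real.exp (-y ^ 2) * |y - t| ^ s := by
  obtain ⟨C, h⟩ := hf.exists_le_exp_neg_half_sq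
  have hC : 0 ≤ C := by simpa using (abs_nonneg _).trans (h 0)
  have h1 := ((integrable_abs_rpow_mul_exp_neg_mul_sq (b := 1 / 4) (by norm_num) hs).comp_sub_right
    t).const_mul (C * Real.exp (t ^ 2 / 2))
  refine h1.mono' ?_ (Filter.Eventually.of_forall fun y => ?_)
  · have := hf.continuous.measurable
    exact (by fun_prop : Measurable _).aestronglyMeasurable
  · rw [Real.norm_eq_abs, abs_mul, abs_of_nonneg (Real.rpow_nonneg (abs_nonneg (y - t)) s)]
    calc |f y * Real.exp (-y ^ 2)| * |y - t| ^ s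
        ≤ C * Real.exp (-(1 / 2) * y ^ 2) * |y - t| ^ s := by
          gcongr
          exact h y
      _ ≤ C * Real.exp (t ^ 2 / 2 + -(1 / 4) * (y - t) ^ 2) * |y - t| ^ s := by
          gcongr
          nlinarith [sq_nonneg (y + t)]
      _ = _ := by
          rw [Real.exp_add]
          ring

theorem abs_rpow_sub_rpow_le {c a b : ℝ} (hc : 0 < c) (ha : 0 < a) (hb : 0 ≤ b)
    (hab : b ≤ a + 1) :
    |b ^ c - a ^ c| ≤ (a ^ (c - 1) + c * Real.exp (c * a)) * |b - a| := by
  have key : ∀ u v : ℝ, 0 ≤ u → u ≤ v → 0 < v →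
      v ^ c - u ^ c ≤ max 1 c * v ^ (c - 1) * (v - u) := by
    intro u v hu huv hv
    have huv' : 0 ≤ u / v := div_nonneg hu hv.le
    have e1 : u ^ c = v ^ c * (u / v) ^ c := by
      rw [Real.div_rpow hu hv.le]
      field_simp
    have e2 : v ^ c = v ^ (c - 1) * v := by
      rw [← Real.rpow_add_one hv.ne', sub_add_cancel]
    have hvp : 0 < v ^ (c - 1) := Real.rpow_pos_of_pos hv _
    have h3 : 1 - (u / v) ^ c ≤ max 1 c * (1 - u / v) := by
      rcases le_total 1 c with h1 | h1
      · have := one_add_mul_self_le_rpow_one_add (s := u / v - 1) (by linarith) h1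
        rw [add_sub_cancel] at this
        rw [max_eq_right h1]
        linarith
      · rw [max_eq_left h1, one_mul]
        have := Real.rpow_le_rpow_of_exponent_ge' huv' ((div_le_one hv).2 huv) hc.le h1
        rw [Real.rpow_one] at this
        linarith
    calc v ^ c - u ^ c = v ^ (c - 1) * v * (1 - (u / v) ^ c) := by rw [e1, ← e2]; ring
      _ ≤ v ^ (c - 1) * v * (max 1 c * (1 - u / v)) := by gcongr
      _ = _ := by field_simp
  have key2 : |b ^ c - a ^ c| ≤ max 1 c * (max a b) ^ (c - 1) * |b - a| := by
    rcases le_total a b with h | h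
    · rw [abs_of_nonneg (sub_nonneg.2 (Real.rpow_le_rpow ha.le h hc.le)), max_eq_right h,
        abs_of_nonneg (sub_nonneg.2 h)]
      exact key a b ha.le h (ha.trans_le h)
    · rw [abs_sub_comm, abs_of_nonneg (sub_nonneg.2 (Real.rpow_le_rpow hb h hc.le)),
        max_eq_left h, abs_sub_comm, abs_of_nonneg (sub_nonneg.2 h)]
      exact key b a hb h ha
  refine key2.trans (mul_le_mul_of_nonneg_right ?_ (abs_nonneg _))
  rcases le_total 1 c with h1 | h1
  · rw [max_eq_right h1]
    have h2 : (max a b) ^ (c - 1) ≤ Real.exp (c * a) := by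
      calc (max a b) ^ (c - 1) ≤ (Real.exp a) ^ (c - 1) :=
            Real.rpow_le_rpow (ha.le.trans (le_max_left _ _))
              ((max_le (by linarith) hab).trans (Real.add_one_le_exp a)) (by linarith)
        _ = Real.exp (a * (c - 1)) := (Real.exp_mul _ _).symm
        _ ≤ _ := Real.exp_le_exp.2 (by nlinarith)
    have := Real.rpow_nonneg ha.le (c - 1)
    nlinarith
  · rw [max_eq_left h1, one_mul]
    have h2 := Real.rpow_le_rpow_of_nonpos ha (le_max_left a b) (by linarith : c - 1 ≤ 0)
    have := mul_nonneg hc.le (Real.exp_pos (c * a)).le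
    linarith

section JacobiGauss

variable {N : ℕ} (γ x : Fin N → ℝ)

/-- The Gaussian weight multiplied by the factors `|y - x k| ^ γ k`. -/
noncomputable def gaussWeight (y : ℝ) : ℝ :=
  Real.exp (-y ^ 2) * ∏ k, |y - x k| ^ γ k

/-- The product of all factors `|y - x k| ^ γ k` except the one at `j`. -/
noncomputable def gaussWeightRest (j : Fin N) (y : ℝ) : ℝ :=
  ∏ k ∈ Finset.univ.erase j, |y - x k| ^ γ k

variable {γ x}

theorem gaussWeight_eq_rest_mul (j : Fin N) (y : ℝ) :
    gaussWeight γ x y = gaussWeightRest γ x j y * Real.exp (-y ^ 2) * |y - x j| ^ γ j := by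
  rw [gaussWeight, gaussWeightRest, ← Finset.mul_prod_erase _ _ (Finset.mem_univ j)]
  ring

theorem gaussWeight_update (j : Fin N) (s y : ℝ) :
    gaussWeight γ (Function.update x j s) y =
      gaussWeightRest γ x j y * Real.exp (-y ^ 2) * |y - s| ^ γ j := by
  rw [gaussWeight_eq_rest_mul j, Function.update_self]
  congr 2
  refine Finset.prod_congr rfl fun k hk => ?_
  rw [Function.update_of_ne (Finset.ne_of_mem_erase hk)]

theorem expGrowth_gaussWeightRest (hγ : ∀ j, 0 < γ j) (j : Fin N) :
    ExpGrowth (gaussWeightRest γ x j) :=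
  ExpGrowth.prod _ fun k _ => ExpGrowth.abs_sub_rpow (hγ k).le (x k)

theorem expGrowth_eval_mul_prod (hγ : ∀ j, 0 < γ j) (F : ℝ[X]) :
    ExpGrowth fun y => F.eval y * ∏ k, |y - x k| ^ γ k :=
  (ExpGrowth.polynomial F).mul <|
    ExpGrowth.prod _ fun k _ => ExpGrowth.abs_sub_rpow (hγ k).le (x k)

theorem integrable_eval_mul_gaussWeight (hγ : ∀ j, 0 < γ j) (F : ℝ[X]) :
    Integrable fun y => F.eval y * gaussWeight γ x y := by
  have := (expGrowth_eval_mul_prod (x := x) hγ F).integrable 0 (s := 0) (by norm_num)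
  simp only [Real.rpow_zero, mul_one] at this
  refine this.congr (Filter.Eventually.of_forall fun y => ?_)
  simp only [gaussWeight]
  ring

theorem integrable_eval_mul_gaussWeight_div (hγ : ∀ j, 0 < γ j) (F : ℝ[X]) (j : Fin N) :
    Integrable fun y => F.eval y * gaussWeight γ x y / (y - x j) := by
  have hG := (ExpGrowth.polynomial F).mul (expGrowth_gaussWeightRest (x := x) hγ j)
  have h1 := hG.integrable (x j) (s := γ j - 1) (by linarith [hγ j])
  have hne : ∀ᵐ y : ℝ, y ≠ x j := by simp [ae_iff]
  refine h1.norm.mono' ?_ (hne.mono fun y hy => le_of_eq ?_)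
  · have := hG.continuous.measurable
    simp only [gaussWeight_eq_rest_mul j]
    have h2 : Measurable fun y => (F.eval y * gaussWeightRest γ x j y) *
        (Real.exp (-y ^ 2) * |y - x j| ^ γ j / (y - x j)) := this.mul (by fun_prop)
    refine h2.aestronglyMeasurable.congr (Filter.Eventually.of_forall fun y => ?_)
    ring
  · rw [gaussWeight_eq_rest_mul j, Real.norm_eq_abs, Real.norm_eq_abs, abs_div, abs_mul,
      abs_mul (_ * _) (|y - x j| ^ γ j), abs_mul _ (|y - x j| ^ (γ j - 1)),
      Real.abs_rpow_of_nonneg (abs_nonneg _), Real.abs_rpow_of_nonneg (abs_nonneg _), abs_abs,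
      Real.rpow_sub_one (abs_ne_zero.2 (sub_ne_zero.2 hy))]
    simp only [abs_mul]
    ring

theorem hasDerivAt_abs_rpow_of_ne {u : ℝ} (hu : u ≠ 0) (c : ℝ) :
    HasDerivAt (fun v : ℝ => |v| ^ c) (c * |u| ^ c / u) u := by
  have h1 := (hasDerivAt_abs hu).rpow_const (p := c) (Or.inl (abs_ne_zero.2 hu))
  convert h1 using 1
  rw [Real.rpow_sub_one (abs_ne_zero.2 hu)]
  rcases hu.lt_or_gt with h | h
  · simp [sign_neg h, abs_of_neg h]; field_simp
  · simp [sign_pos h, abs_of_pos h]; field_simp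

theorem hasDerivAt_gaussWeight {y : ℝ} (hy : ∀ k, y ≠ x k) :
    HasDerivAt (gaussWeight γ x)
      (gaussWeight γ x y * (-2 * y + ∑ k, γ k / (y - x k))) y := by
  have h1 : ∀ k ∈ Finset.univ, HasDerivAt (fun y => |y - x k| ^ γ k)
      (γ k * |y - x k| ^ γ k / (y - x k)) y := fun k _ =>
    (hasDerivAt_abs_rpow_of_ne (sub_ne_zero.2 (hy k)) (γ k)).comp_sub_const y (x k)
  have h2 := HasDerivAt.fun_finsetProd h1
  have h3 : HasDerivAt (fun y : ℝ => Real.exp (-y ^ 2)) (Real.exp (-y ^ 2) * (-(2 * y))) y := by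
    have := ((hasDerivAt_pow 2 y).neg).exp
    simpa using this
  refine (h3.mul h2).congr_deriv (Eq.symm ?_)
  rw [mul_add, Finset.mul_sum, Finset.mul_sum, gaussWeight]
  congr 1
  · ring
  · refine Finset.sum_congr rfl fun k hk => ?_
    rw [← Finset.mul_prod_erase _ _ hk, smul_eq_mul]
    ring

theorem integral_derivative_mul_gaussWeight (hγ : ∀ j, 0 < γ j) (F : ℝ[X]) :
    ∫ y, F.derivative.eval y * gaussWeight γ x y =
      2 * (∫ y, (X * F).eval y * gaussWeight γ x y) -
        ∑ k, γ k * ∫ y, F.eval y * gaussWeight γ x y / (y - x k) := by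
  have i1 := integrable_eval_mul_gaussWeight (x := x) hγ F.derivative
  have i2 := (integrable_eval_mul_gaussWeight (x := x) hγ (X * F)).const_mul 2
  have i3 : ∀ k ∈ Finset.univ,
      Integrable fun y => γ k * (F.eval y * gaussWeight γ x y / (y - x k)) := fun k _ =>
    (integrable_eval_mul_gaussWeight_div (x := x) hγ F k).const_mul (γ k)
  have i4 := integrable_finsetSum _ i3
  set g : ℝ → ℝ := fun y => F.eval y * gaussWeight γ x y with hg
  set g' : ℝ → ℝ := fun y => F.derivative.eval y * gaussWeight γ x y -
    2 * ((X * F).eval y * gaussWeight γ x y) +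
      ∑ k, γ k * (F.eval y * gaussWeight γ x y / (y - x k)) with hg'
  have hgE : g = fun y => (F.eval y * ∏ k, |y - x k| ^ γ k) * Real.exp (-y ^ 2) := by
    funext y
    simp only [hg, gaussWeight]
    ring
  have hE := expGrowth_eval_mul_prod (x := x) hγ F
  have hcont : Continuous g := by
    rw [hgE]
    exact hE.continuous.mul (by fun_prop)
  have hlim : Filter.Tendsto g (Filter.cocompact ℝ) (nhds 0) := by
    rw [hgE]
    exact hE.tendsto_mul_exp_neg_sq
  have hint : Integrable g' := (i1.sub i2).add i4
  have hderiv : ∀ y, y ∉ Set.range x → HasDerivAt g (g' y) y := by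
    intro y hy
    have hy' : ∀ k, y ≠ x k := fun k hk => hy ⟨k, hk.symm⟩
    refine ((F.hasDerivAt y).mul (hasDerivAt_gaussWeight (γ := γ) hy')).congr_deriv (Eq.symm ?_)
    simp only [hg', mul_add, Finset.mul_sum, eval_mul, eval_X]
    rw [sub_add, sub_eq_add_neg]
    congr 1
    rw [neg_sub, sub_eq_add_neg, add_comm]
    congr 1
    · ring
    · refine Finset.sum_congr rfl fun k _ => ?_
      ring
  have hFTC : ∀ r : ℝ, ∫ y in (-r)..r, g' y = g r - g (-r) := fun r =>
    integral_eq_of_hasDerivAt_off_countable g g' (Set.countable_range x) hcont.continuousOn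
      (fun y hy => hderiv y hy.2) hint.intervalIntegrable
  have t1 := intervalIntegral_tendsto_integral hint Filter.tendsto_neg_atTop_atBot Filter.tendsto_id
  have t2 : Filter.Tendsto (fun r => g r - g (-r)) Filter.atTop (nhds (0 - 0)) :=
    (hlim.mono_left atTop_le_cocompact).sub
      ((hlim.mono_left atBot_le_cocompact).comp Filter.tendsto_neg_atTop_atBot)
  have h0 : ∫ y, g' y = 0 := by
    rw [← sub_zero (0 : ℝ)]
    exact tendsto_nhds_unique t1 (t2.congr fun r => (hFTC r).symm)
  have h1 : ∫ y, g' y = _ := integral_add (i1.sub i2) i4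
  rw [h0, integral_sub i1 i2, integral_finsetSum _ i3, integral_const_mul] at h1
  simp only [integral_const_mul] at h1
  linarith

theorem hasDerivAt_integral_eval_mul_gaussWeight (hγ : ∀ j, 0 < γ j) (F : ℝ[X]) (j : Fin N) :
    HasDerivAt (fun s => ∫ y, F.eval y * gaussWeight γ (Function.update x j s) y)
      (-(γ j * ∫ y, F.eval y * gaussWeight γ x y / (y - x j))) (x j) := by
  have hG := (ExpGrowth.polynomial F).mul (expGrowth_gaussWeightRest (x := x) hγ j)
  set G : ℝ → ℝ := fun y => F.eval y * gaussWeightRest γ x j y with hGdef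
  have hF' : ∀ s y, F.eval y * gaussWeight γ (Function.update x j s) y =
      G y * Real.exp (-y ^ 2) * |y - s| ^ γ j := fun s y => by
    rw [gaussWeight_update, hGdef]
    ring
  have hne : ∀ᵐ y : ℝ, y ≠ x j := by simp [ae_iff]
  have hγj := hγ j
  have hb1 := hG.integrable (x j) (s := γ j - 1) (by linarith)
  have hb2 := (hG.mul (ExpGrowth.exp_abs_sub hγj.le (x j))).integrable 0 (s := 0) (by norm_num)
  simp only [Real.rpow_zero, mul_one] at hb2
  have key := hasFDerivAt_integral_of_dominated_loc_of_lip' (𝕜 := ℝ) (μ := volume)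
    (F := fun s y => F.eval y * gaussWeight γ (Function.update x j s) y) (x₀ := x j)
    (s := Metric.ball (x j) 1)
    (F' := fun y => ContinuousLinearMap.toSpanSingleton ℝ
      (-γ j * (F.eval y * gaussWeight γ x y / (y - x j))))
    (bound := fun y => ‖G y * Real.exp (-y ^ 2) * |y - x j| ^ (γ j - 1)‖ +
      γ j * ‖G y * Real.exp (γ j * |y - x j|) * Real.exp (-y ^ 2)‖)
    (Metric.ball_mem_nhds _ one_pos) ?_ ?_ ?_ ?_ ?_ ?_
  · have h2 := key.2.hasDerivAt
    rw [ContinuousLinearMap.integral_apply key.1] at h2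
    simpa only [ContinuousLinearMap.toSpanSingleton_apply, one_smul, integral_const_mul,
      neg_mul, integral_neg] using h2
  · intro s _
    exact (integrable_eval_mul_gaussWeight hγ F).aestronglyMeasurable
  · exact integrable_eval_mul_gaussWeight hγ F
  · exact (ContinuousLinearMap.toSpanSingletonCLE
      (𝕜 := ℝ) (E := ℝ)).continuous.comp_aestronglyMeasurable
      ((integrable_eval_mul_gaussWeight_div hγ F j).const_mul (-γ j)).aestronglyMeasurable
  · filter_upwards [hne] with y hy s hs
    rw [Metric.mem_ball, Real.dist_eq] at hs
    have hpos : 0 < |y - x j| := abs_pos.2 (sub_ne_zero.2 hy)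
    have habs : |(|y - s| - |y - x j|)| ≤ |s - x j| := by
      refine (abs_abs_sub_abs_le _ _).trans (le_of_eq ?_)
      rw [sub_sub_sub_cancel_left, abs_sub_comm]
    have h1 := abs_rpow_sub_rpow_le hγj hpos (abs_nonneg (y - s))
      (by linarith [le_abs_self (|y - s| - |y - x j|)])
    have hA := Real.rpow_nonneg hpos.le (γ j - 1)
    rw [hF', hF', ← mul_sub, norm_mul, Real.norm_eq_abs (_ - _)]
    calc _ ≤ ‖G y * Real.exp (-y ^ 2)‖ * ((|y - x j| ^ (γ j - 1) +
          γ j * Real.exp (γ j * |y - x j|)) * |s - x j|) := by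
          gcongr
          exact h1.trans (by gcongr)
      _ = _ := by
          simp only [norm_mul, Real.norm_eq_abs, Real.abs_exp, abs_of_nonneg hA]
          ring
  · exact hb1.norm.add (hb2.norm.const_mul _)
  · filter_upwards [hne] with y hy
    have h1 := ((hasDerivAt_abs_rpow_of_ne (sub_ne_zero.2 hy) (γ j)).comp_const_sub y
      (x j)).const_mul (G y * Real.exp (-y ^ 2))
    have h2 : HasDerivAt (fun s => F.eval y * gaussWeight γ (Function.update x j s) y)
        (-γ j * (F.eval y * gaussWeight γ x y / (y - x j))) (x j) := by
      simp only [hF']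
      refine h1.congr_deriv (Eq.symm ?_)
      rw [gaussWeight_eq_rest_mul j, hGdef]
      ring
    exact h2.hasFDerivAt

end JacobiGauss

namespace Polynomial

theorem linearMap_apply_eq_sum_range (Λ : ℝ[X] →ₗ[ℝ] ℝ) {F : ℝ[X]} {n : ℕ}
    (hF : F.natDegree ≤ n) :
    Λ F = ∑ k ∈ Finset.range (n + 1), F.coeff k * Λ (X ^ k) := by
  conv_lhs => rw [F.as_sum_range_C_mul_X_pow' (Nat.lt_succ_of_le hF)]
  simp only [map_sum, C_mul', map_smul, smul_eq_mul]

section Orthogonal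

variable {L : ℝ[X] →ₗ[ℝ] ℝ} {P : ℕ → ℝ[X]}

theorem orthogonal_of_natDegree_lt (hmonic : ∀ n, (P n).Monic) (hdeg : ∀ n, (P n).natDegree = n)
    (horth : ∀ m n, m ≠ n → L (P m * P n) = 0) {n : ℕ} :
    ∀ d ≤ n, ∀ F : ℝ[X], F.degree < d → L (P n * F) = 0 := by
  intro d
  induction d with
  | zero =>
    intro _ F hF
    have hF0 : F = 0 := by
      ext k
      exact (degree_lt_iff_coeff_zero F 0).1 hF k k.zero_le
    simp [hF0]
  | succ d ih =>
    intro hd F hF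
    have h1 : (F - C (F.coeff d) * P d).degree < d := by
      rw [degree_lt_iff_coeff_zero]
      intro k hk
      rcases hk.eq_or_lt with rfl | hk
      · have := (hmonic d).coeff_natDegree
        rw [hdeg] at this
        simp [this]
      · have h2 : F.coeff k = 0 := (degree_lt_iff_coeff_zero _ _).1 hF k hk
        have h3 : (P d).coeff k = 0 := coeff_eq_zero_of_natDegree_lt (by rwa [hdeg])
        simp [h2, h3]
    have h2 := ih (Nat.le_of_succ_le hd) _ h1
    have h3 := horth n d (Nat.lt_of_succ_le hd).ne'
    rw [mul_sub, map_sub, mul_left_comm, C_mul', map_smul, h3, smul_zero, sub_zero] at h2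
    exact h2

theorem apply_mul_of_natDegree_le (hmonic : ∀ n, (P n).Monic) (hdeg : ∀ n, (P n).natDegree = n)
    (horth : ∀ m n, m ≠ n → L (P m * P n) = 0) {n : ℕ} {F : ℝ[X]} (hF : F.natDegree ≤ n) :
    L (P n * F) = F.coeff n * L (P n * P n) := by
  have h1 : (F - C (F.coeff n) * P n).degree < n := by
    rw [degree_lt_iff_coeff_zero]
    intro k hk
    rcases hk.eq_or_lt with rfl | hk
    · have := (hmonic n).coeff_natDegree
      rw [hdeg] at this
      simp [this]
    · have h2 : F.coeff k = 0 := coeff_eq_zero_of_natDegree_lt (hF.trans_lt hk)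
      have h3 : (P n).coeff k = 0 := coeff_eq_zero_of_natDegree_lt (by rwa [hdeg])
      simp [h2, h3]
  have h2 := orthogonal_of_natDegree_lt hmonic hdeg horth n le_rfl _ h1
  rw [mul_sub, map_sub, mul_left_comm, C_mul', map_smul, smul_eq_mul] at h2
  linarith

theorem apply_mul_X_mul (hmonic : ∀ n, (P n).Monic) (hdeg : ∀ n, (P n).natDegree = n)
    (horth : ∀ m n, m ≠ n → L (P m * P n) = 0) (n : ℕ) :
    L (P n * (X * P n)) = ((X * P n).coeff n - (P (n + 1)).coeff n) * L (P n * P n) := by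
  have h1 : (X * P n - P (n + 1)).natDegree ≤ n := by
    rw [natDegree_le_iff_coeff_eq_zero]
    intro k hk
    obtain ⟨k, rfl⟩ : ∃ i, k = i + 1 := ⟨k - 1, by omega⟩
    rw [coeff_sub, coeff_X_mul]
    rcases (Nat.lt_succ_iff.1 hk).eq_or_lt with rfl | hk
    · have h2 := (hmonic n).coeff_natDegree
      have h3 := (hmonic (n + 1)).coeff_natDegree
      rw [hdeg] at h2 h3
      rw [h2, h3, sub_self]
    · rw [coeff_eq_zero_of_natDegree_lt (by rwa [hdeg]),
        coeff_eq_zero_of_natDegree_lt (by rw [hdeg]; omega), sub_self]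
  have h2 := apply_mul_of_natDegree_le hmonic hdeg horth h1
  rwa [mul_sub, map_sub, horth n (n + 1) (by omega), sub_zero, coeff_sub] at h2

theorem apply_succ_mul_X_mul (hmonic : ∀ n, (P n).Monic) (hdeg : ∀ n, (P n).natDegree = n)
    (horth : ∀ m n, m ≠ n → L (P m * P n) = 0) (n : ℕ) :
    L (P (n + 1) * (X * P n)) = L (P (n + 1) * P (n + 1)) := by
  have h1 : (X * P n).natDegree ≤ n + 1 := by
    rw [natDegree_X_mul (hmonic n).ne_zero, hdeg]
  have h2 := (hmonic n).coeff_natDegree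
  rw [hdeg] at h2
  rw [apply_mul_of_natDegree_le hmonic hdeg horth h1, coeff_X_mul, h2, one_mul]

theorem apply_derivative_mul_self (hmonic : ∀ n, (P n).Monic) (hdeg : ∀ n, (P n).natDegree = n)
    (horth : ∀ m n, m ≠ n → L (P m * P n) = 0) (n : ℕ) :
    L (derivative (P n * P n)) = 0 := by
  have h1 : (derivative (P n)).degree < n := by
    have := degree_derivative_lt (hmonic n).ne_zero
    rwa [degree_eq_natDegree (hmonic n).ne_zero, hdeg] at this
  rw [derivative_mul, map_add, mul_comm (derivative (P n)),
    orthogonal_of_natDegree_lt hmonic hdeg horth n le_rfl _ h1, add_zero]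

theorem apply_derivative_succ_mul (hmonic : ∀ n, (P n).Monic) (hdeg : ∀ n, (P n).natDegree = n)
    (horth : ∀ m n, m ≠ n → L (P m * P n) = 0) (n : ℕ) :
    L (derivative (P (n + 1) * P n)) = (n + 1) * L (P n * P n) := by
  have h1 : (derivative (P n)).degree < n := by
    have := degree_derivative_lt (hmonic n).ne_zero
    rwa [degree_eq_natDegree (hmonic n).ne_zero, hdeg] at this
  have h2 : (derivative (P (n + 1))).natDegree ≤ n := by
    have := natDegree_derivative_le (P (n + 1))
    rwa [hdeg] at this
  have h3 := (hmonic (n + 1)).coeff_natDegree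
  rw [hdeg] at h3
  rw [derivative_mul, map_add, mul_comm (derivative (P (n + 1))),
    apply_mul_of_natDegree_le hmonic hdeg horth h2, coeff_derivative, h3, one_mul,
    orthogonal_of_natDegree_lt hmonic hdeg horth (n + 1) le_rfl _
      (h1.trans (by exact_mod_cast Nat.lt_succ_self n)), add_zero]

theorem pole_apply_mul {K : ℝ[X] →ₗ[ℝ] ℝ} {t : ℝ} (hK : ∀ F, K ((X - C t) * F) = L F)
    (F G : ℝ[X]) : K (F * G) = G.eval t * K F + L (F * (G /ₘ (X - C t))) := by
  conv_lhs => rw [← modByMonic_add_div G (X - C t), modByMonic_X_sub_C_eq_C_eval, mul_add,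
    mul_comm F (C _), mul_left_comm F, map_add, hK, C_mul', map_smul, smul_eq_mul]

theorem pole_apply_succ_mul_sub (hmonic : ∀ n, (P n).Monic) (hdeg : ∀ n, (P n).natDegree = n)
    (horth : ∀ m n, m ≠ n → L (P m * P n) = 0) {K : ℝ[X] →ₗ[ℝ] ℝ} {t : ℝ}
    (hK : ∀ F, K ((X - C t) * F) = L F) (n : ℕ) :
    K (P (n + 1) * P n) * (K (P (n + 1) * P n) - L (P n * P n)) =
      K (P (n + 1) * P (n + 1)) * K (P n * P n) := by
  have hq : ∀ m, (P m /ₘ (X - C t)).degree < m := fun m => by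
    have := degree_divByMonic_lt (P m) (q := X - C t)
      (hmonic m).ne_zero (by rw [degree_X_sub_C]; exact one_pos)
    rwa [degree_eq_natDegree (hmonic m).ne_zero, hdeg] at this
  have hqd : (P (n + 1) /ₘ (X - C t)).natDegree = n := by
    rw [natDegree_divByMonic _ (monic_X_sub_C t), hdeg, natDegree_X_sub_C, Nat.add_sub_cancel]
  have hqc : (P (n + 1) /ₘ (X - C t)).coeff n = 1 := by
    rw [← (hmonic (n + 1)).leadingCoeff, ← leadingCoeff_divByMonic_of_monic (monic_X_sub_C t)
      (by rw [degree_X_sub_C, degree_eq_natDegree (hmonic _).ne_zero, hdeg]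
          exact_mod_cast Nat.succ_pos n), leadingCoeff, hqd]
  have e0 := fun m => orthogonal_of_natDegree_lt hmonic hdeg horth m le_rfl _ (hq m)
  have e1 := pole_apply_mul hK (P (n + 1)) (P n)
  rw [orthogonal_of_natDegree_lt hmonic hdeg horth (n + 1) le_rfl _
    ((hq n).trans (by exact_mod_cast Nat.lt_succ_self n)), add_zero] at e1
  have e2 := pole_apply_mul hK (P n) (P (n + 1))
  rw [apply_mul_of_natDegree_le hmonic hdeg horth hqd.le, hqc, one_mul, mul_comm (P n)] at e2
  have e3 := pole_apply_mul hK (P n) (P n)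
  have e4 := pole_apply_mul hK (P (n + 1)) (P (n + 1))
  rw [e0, add_zero] at e3 e4
  rw [e3, e4]
  nth_rewrite 2 [e2]
  rw [e1]
  ring

end Orthogonal

theorem hasDerivAt_coeff_mul {A B : ℝ → ℝ[X]} {A' B' : ℝ[X]} {t : ℝ}
    (hA : ∀ k, HasDerivAt (fun s => (A s).coeff k) (A'.coeff k) t)
    (hB : ∀ k, HasDerivAt (fun s => (B s).coeff k) (B'.coeff k) t) (k : ℕ) :
    HasDerivAt (fun s => (A s * B s).coeff k) ((A' * B t + A t * B').coeff k) t := by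
  simp only [coeff_add, coeff_mul, ← Finset.sum_add_distrib]
  exact HasDerivAt.fun_sum fun i _ => (hA i.1).mul (hB i.2)

end Polynomial

section JacobiGauss

variable {N : ℕ} {γ : Fin N → ℝ}

/-- The moment functional of `gaussWeight γ x` on polynomials. -/
noncomputable def gaussMoment (hγ : ∀ j, 0 < γ j) (x : Fin N → ℝ) : ℝ[X] →ₗ[ℝ] ℝ where
  toFun F := ∫ y, F.eval y * gaussWeight γ x y
  map_add' F G := by
    simp only [eval_add, add_mul]
    exact integral_add (integrable_eval_mul_gaussWeight hγ F) (integrable_eval_mul_gaussWeight hγ G)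
  map_smul' c F := by
    simp only [eval_smul, smul_eq_mul, mul_assoc, integral_const_mul, RingHom.id_apply]

/-- The functional `F ↦ ∫ F(y) w(y) / (y - x j)` for `w = gaussWeight γ x`. -/
noncomputable def gaussPoleMoment (hγ : ∀ j, 0 < γ j) (x : Fin N → ℝ) (j : Fin N) :
    ℝ[X] →ₗ[ℝ] ℝ where
  toFun F := ∫ y, F.eval y * gaussWeight γ x y / (y - x j)
  map_add' F G := by
    simp only [eval_add, add_mul, add_div]
    exact integral_add (integrable_eval_mul_gaussWeight_div hγ F j)
      (integrable_eval_mul_gaussWeight_div hγ G j)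
  map_smul' c F := by
    simp only [eval_smul, smul_eq_mul, mul_assoc, mul_div_assoc, integral_const_mul,
      RingHom.id_apply]

variable (hγ : ∀ j, 0 < γ j) (x : Fin N → ℝ)

theorem gaussPoleMoment_X_sub_C_mul (j : Fin N) (F : ℝ[X]) :
    gaussPoleMoment hγ x j ((X - C (x j)) * F) = gaussMoment hγ x F := by
  have hne : ∀ᵐ y : ℝ, y ≠ x j := by simp [ae_iff]
  refine integral_congr_ae (hne.mono fun y hy => ?_)
  have := sub_ne_zero.2 hy
  simp only [eval_mul, eval_sub, eval_X, eval_C]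
  field_simp

theorem gaussMoment_derivative (F : ℝ[X]) :
    gaussMoment hγ x (derivative F) =
      2 * gaussMoment hγ x (X * F) - ∑ k, γ k * gaussPoleMoment hγ x k F :=
  integral_derivative_mul_gaussWeight hγ F

theorem hasDerivAt_gaussMoment (j : Fin N) {A : ℝ → ℝ[X]} {A' : ℝ[X]} {n : ℕ}
    (hA : ∀ k, HasDerivAt (fun s => (A s).coeff k) (A'.coeff k) (x j))
    (hdeg : ∀ᶠ s in nhds (x j), (A s).natDegree ≤ n) :
    HasDerivAt (fun s => gaussMoment hγ (Function.update x j s) (A s))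
      (gaussMoment hγ x A' - γ j * gaussPoleMoment hγ x j (A (x j))) (x j) := by
  have hA' : A'.natDegree ≤ n := by
    rw [natDegree_le_iff_coeff_eq_zero]
    intro k hk
    refine (hA k).unique ((hasDerivAt_const (x j) (0 : ℝ)).congr_of_eventuallyEq ?_)
    filter_upwards [hdeg] with s hs
    exact coeff_eq_zero_of_natDegree_lt (hs.trans_lt hk)
  have h1 : HasDerivAt (fun s => ∑ k ∈ Finset.range (n + 1),
      (A s).coeff k * gaussMoment hγ (Function.update x j s) (X ^ k))
      (∑ k ∈ Finset.range (n + 1), (A'.coeff k * gaussMoment hγ x (X ^ k) +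
        (A (x j)).coeff k * -(γ j * gaussPoleMoment hγ x j (X ^ k)))) (x j) := by
    refine HasDerivAt.fun_sum fun k _ => ?_
    have := (hA k).mul (hasDerivAt_integral_eval_mul_gaussWeight (x := x) hγ (X ^ k) j)
    simpa only [Function.update_eq_self] using! this
  rw [linearMap_apply_eq_sum_range _ hA', linearMap_apply_eq_sum_range _ hdeg.self_of_nhds,
    Finset.mul_sum, ← Finset.sum_sub_distrib]
  refine (h1.congr_of_eventuallyEq ?_).congr_deriv (Finset.sum_congr rfl fun k _ => by ring)
  filter_upwards [hdeg] with s hs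
  exact linearMap_apply_eq_sum_range _ hs

end JacobiGauss

section PartialDerivatives

variable {N : ℕ} {U : Set (Fin N → ℝ)} {x : Fin N → ℝ}

theorem eventually_update_mem (hU : IsOpen U) (hx : x ∈ U) (j : Fin N) :
    ∀ᶠ s in nhds (x j), Function.update x j s ∈ U := by
  have hc : Continuous fun s : ℝ => Function.update x j s := continuous_const.update j continuous_id
  exact hc.continuousAt.eventually_mem (by
    rw [Function.update_eq_self]
    exact hU.mem_nhds hx)

theorem pd_congr (hU : IsOpen U) (hx : x ∈ U) {f g : (Fin N → ℝ) → ℝ} (hfg : ∀ y ∈ U, f y = g y)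
    (j : Fin N) : pd j f x = pd j g x :=
  Filter.EventuallyEq.deriv_eq <| (eventually_update_mem hU hx j).mono fun _ hs => hfg _ hs

theorem hasDerivAt_update_of_hasFDerivAt {f : (Fin N → ℝ) → ℝ} {f' : (Fin N → ℝ) →L[ℝ] ℝ}
    (hf : HasFDerivAt f f' x) (j : Fin N) :
    HasDerivAt (fun s => f (Function.update x j s)) (f' (Pi.single j 1)) (x j) := by
  rw [← Function.update_eq_self j x] at hf
  exact hf.comp_hasDerivAt (x j) (hasDerivAt_update x j (x j))

theorem ContDiffOn.hasDerivAt_pd (hU : IsOpen U) (hx : x ∈ U) {f : (Fin N → ℝ) → ℝ}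
    (hf : ContDiffOn ℝ 2 f U) (j : Fin N) :
    HasDerivAt (fun s => f (Function.update x j s)) (pd j f x) (x j) :=
  (hasDerivAt_update_of_hasFDerivAt
    ((hf.contDiffAt (hU.mem_nhds hx)).differentiableAt two_ne_zero).hasFDerivAt
      j).differentiableAt.hasDerivAt

theorem pd_comm (hU : IsOpen U) (hx : x ∈ U) {f : (Fin N → ℝ) → ℝ} (hf : ContDiffOn ℝ 2 f U)
    (j k : Fin N) : pd j (pd k f) x = pd k (pd j f) x := by
  have h1 : ∀ i, ∀ y ∈ U, pd i f y = fderiv ℝ f y (Pi.single i 1) := fun i y hy =>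
    (hasDerivAt_update_of_hasFDerivAt
      ((hf.contDiffAt (hU.mem_nhds hy)).differentiableAt two_ne_zero).hasFDerivAt i).deriv
  have hfx := hf.contDiffAt (hU.mem_nhds hx)
  have h2 : DifferentiableAt ℝ (fderiv ℝ f) x :=
    (hfx.fderiv_right (m := 1) (by norm_num)).differentiableAt one_ne_zero
  have h3 : ∀ i l, pd l (pd i f) x = fderiv ℝ (fderiv ℝ f) x (Pi.single l 1) (Pi.single i 1) := by
    intro i l
    rw [pd_congr hU hx (h1 i) l]
    refine (hasDerivAt_update_of_hasFDerivAt
      (h2.hasFDerivAt.clm_apply (hasFDerivAt_const (Pi.single i (1 : ℝ)) x)) l).deriv.trans ?_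
    simp
  rw [h3, h3]
  exact hfx.isSymmSndFDerivAt (by simp) _ _

end PartialDerivatives

theorem eq_root_of_quadratic_data {B a b q γ s D : ℝ} (hB : 0 < B)
    (hs : s = 4 * B * (b - a)) (hq : q * (q - γ) = B * a * b)
    (hD : D = s ^ 2 + 4 * (4 * B) * (2 * q) * (2 * q - 2 * γ)) :
    0 ≤ D ∧ a = (-s + Real.sign (a + b) * √D) / (2 * (4 * B)) := by
  have h1 : D = (4 * B * (a + b)) ^ 2 := by
    rw [hD, hs]
    linear_combination 64 * B * hq
  refine ⟨h1 ▸ sq_nonneg _, ?_⟩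
  have h2 : Real.sign (a + b) * √D = 4 * B * (a + b) := by
    rw [h1, Real.sqrt_sq_eq_abs, abs_mul, abs_of_pos (by positivity : 0 < 4 * B), mul_left_comm]
    rcases lt_trichotomy (a + b) 0 with h | h | h
    · rw [Real.sign_of_neg h, abs_of_neg h]; ring
    · simp [h]
    · rw [Real.sign_of_pos h, abs_of_pos h]; ring
  rw [h2, hs]
  field_simp
  ring

theorem R_in_sigma
    (N : ℕ) (hN : 1 ≤ N) (γ : Fin N → ℝ) (hγ : ∀ j, 0 < γ j)
    (U : Set (Fin N → ℝ)) (hU : IsOpen U) (hUinj : ∀ x ∈ U, Function.Injective x)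
    (w : (Fin N → ℝ) → ℝ → ℝ)
    (hw : ∀ x ∈ U, ∀ y : ℝ, w x y = Real.exp (-y ^ 2) * ∏ j, |y - x j| ^ γ j)
    (P : ℕ → (Fin N → ℝ) → Polynomial ℝ)
    (hPmonic : ∀ n, ∀ x ∈ U, (P n x).Monic) (hPdeg : ∀ n, ∀ x ∈ U, (P n x).natDegree = n)
    (horth : ∀ m n, m ≠ n → ∀ x ∈ U, ∫ y : ℝ, (P m x).eval y * (P n x).eval y * w x y = 0)
    (h : ℕ → (Fin N → ℝ) → ℝ)
    (hh : ∀ n, ∀ x ∈ U, h n x = ∫ y : ℝ, ((P n x).eval y) ^ 2 * w x y)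
    (hhpos : ∀ n, ∀ x ∈ U, 0 < h n x)
    (β : ℕ → (Fin N → ℝ) → ℝ) (hβ0 : ∀ x ∈ U, β 0 x = 0)
    (hβ : ∀ n, ∀ x ∈ U, β (n + 1) x = h (n + 1) x / h n x)
    (α : ℕ → (Fin N → ℝ) → ℝ)
    (hα : ∀ n, ∀ x ∈ U, α n x = (∫ y : ℝ, y * ((P n x).eval y) ^ 2 * w x y) / h n x)
    (p : ℕ → (Fin N → ℝ) → ℝ) (hp0 : ∀ x ∈ U, p 0 x = 0)
    (hp : ∀ n, ∀ x ∈ U, p (n + 1) x = (P (n + 1) x).coeff n)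
    (R : ℕ → Fin N → (Fin N → ℝ) → ℝ)
    (hR : ∀ n j, ∀ x ∈ U, R n j x = γ j / h n x * ∫ y : ℝ, ((P n x).eval y) ^ 2 * w x y / (y - x j))
    (r : ℕ → Fin N → (Fin N → ℝ) → ℝ) (hr0 : ∀ j, ∀ x ∈ U, r 0 j x = 0)
    (hr : ∀ n j, ∀ x ∈ U, r (n + 1) j x = γ j / h n x * ∫ y : ℝ, (P (n + 1) x).eval y * (P n x).eval y * w x y / (y - x j))
    (hPC2 : ∀ m k, ContDiffOn ℝ 2 (fun x => (P m x).coeff k) U)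
    (hhC2 : ∀ m, ContDiffOn ℝ 2 (h m) U)
    (hαC2 : ∀ m, ContDiffOn ℝ 2 (α m) U)
    (hβC2 : ∀ m, ContDiffOn ℝ 2 (β m) U)
    (hpC2 : ∀ m, ContDiffOn ℝ 2 (p m) U)
    (hRC2 : ∀ m j, ContDiffOn ℝ 2 (R m j) U)
    (hrC2 : ∀ m j, ContDiffOn ℝ 2 (r m j) U)
    (σ : ℕ → (Fin N → ℝ) → ℝ)
    (hσ : ∀ n, ∀ x ∈ U, σ n x = ∑ k, pd k (fun y => Real.log (∏ i ∈ Finset.range n, h i y)) x)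
    (n : ℕ) (hn : 1 ≤ n) (j : Fin N) (x : Fin N → ℝ) (hx : x ∈ U) (hRne : ∀ j, R n j x ≠ 0) :
    0 ≤ ((pd j (pd j (σ n)) x + ∑ k ∈ Finset.univ.erase j, pd k (pd j (σ n)) x) ^ 2
        + 4 * (2 * (n : ℝ) + ∑ k, pd k (σ n) x) * pd j (σ n) x * (pd j (σ n) x - 2 * γ j)) ∧
      2 * (n : ℝ) + (∑ k, pd k (σ n) x) = 4 * β n x ∧
      0 < 4 * β n x ∧
      R n j x = (-(pd j (pd j (σ n)) x + ∑ k ∈ Finset.univ.erase j, pd k (pd j (σ n)) x)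
          + Real.sign (R n j x + R (n - 1) j x) * Real.sqrt ((pd j (pd j (σ n)) x + ∑ k ∈ Finset.univ.erase j, pd k (pd j (σ n)) x) ^ 2
        + 4 * (2 * (n : ℝ) + ∑ k, pd k (σ n) x) * pd j (σ n) x * (pd j (σ n) x - 2 * γ j)))
        / (2 * (2 * (n : ℝ) + ∑ k, pd k (σ n) x)) := by
  have hP : ∀ z ∈ U, (∀ m, (P m z).Monic) ∧ (∀ m, (P m z).natDegree = m) ∧
      ∀ m i, m ≠ i → gaussMoment hγ z (P m z * P i z) = 0 := fun z hz =>
    ⟨fun m => hPmonic m z hz, fun m => hPdeg m z hz, fun m i hmi => by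
      rw [← horth m i hmi z hz]
      refine integral_congr_ae (Filter.Eventually.of_forall fun y => ?_)
      simp only [eval_mul, hw z hz, gaussWeight]⟩
  have hh' : ∀ m, ∀ z ∈ U, gaussMoment hγ z (P m z * P m z) = h m z := fun m z hz => by
    rw [hh m z hz]
    refine integral_congr_ae (Filter.Eventually.of_forall fun y => ?_)
    simp only [eval_mul, hw z hz, gaussWeight, sq]
  have hR' : ∀ m i, ∀ z ∈ U,
      γ i * gaussPoleMoment hγ z i (P m z * P m z) = h m z * R m i z := fun m i z hz => by
    have e : gaussPoleMoment hγ z i (P m z * P m z) =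
        ∫ y : ℝ, ((P m z).eval y) ^ 2 * w z y / (y - z i) :=
      integral_congr_ae (Filter.Eventually.of_forall fun y => by
        simp only [eval_mul, hw z hz, gaussWeight, sq])
    rw [e, hR m i z hz]
    have := (hhpos m z hz).ne'
    field_simp
  have hr' : ∀ m i, ∀ z ∈ U,
      γ i * gaussPoleMoment hγ z i (P (m + 1) z * P m z) = h m z * r (m + 1) i z :=
    fun m i z hz => by
    have e : gaussPoleMoment hγ z i (P (m + 1) z * P m z) =
        ∫ y : ℝ, (P (m + 1) z).eval y * (P m z).eval y * w z y / (y - z i) :=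
      integral_congr_ae (Filter.Eventually.of_forall fun y => by
        simp only [eval_mul, hw z hz, gaussWeight])
    rw [e, hr m i z hz]
    have := (hhpos m z hz).ne'
    field_simp
  have hD : ∀ m i, ∀ z ∈ U, ∃ D : ℝ[X],
      (∀ k, HasDerivAt (fun s => (P m (Function.update z i s)).coeff k) (D.coeff k) (z i)) ∧
      D.degree < m ∧ ∀ k < m, D.coeff k = pd i (fun y => (P m y).coeff k) z := by
    intro m i z hz
    have hcoeff : ∀ k, (∑ l ∈ Finset.range m,
        monomial l (pd i (fun y => (P m y).coeff l) z)).coeff k =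
        if k < m then pd i (fun y => (P m y).coeff k) z else 0 := fun k => by
      simp [coeff_monomial]
    refine ⟨∑ l ∈ Finset.range m, monomial l (pd i (fun y => (P m y).coeff l) z),
      fun k => ?_, ?_, fun k hk => by rw [hcoeff, if_pos hk]⟩
    · rw [hcoeff]
      split_ifs with hk
      · exact (hPC2 m k).hasDerivAt_pd hU hz i
      · refine (hasDerivAt_const (z i) (if k = m then (1 : ℝ) else 0)).congr_of_eventuallyEq ?_
        filter_upwards [eventually_update_mem hU hz i] with s hs
        split_ifs with hkm
        · have := (hPmonic m _ hs).coeff_natDegree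
          rw [hkm]
          rwa [hPdeg m _ hs] at this
        · exact coeff_eq_zero_of_natDegree_lt (by rw [hPdeg m _ hs]; omega)
    · rw [degree_lt_iff_coeff_zero]
      intro k hk
      rw [hcoeff, if_neg hk.not_gt]
  have hdeg : ∀ m l i, ∀ z ∈ U, ∀ᶠ s in nhds (z i),
      (P m (Function.update z i s) * P l (Function.update z i s)).natDegree ≤ m + l := by
    intro m l i z hz
    filter_upwards [eventually_update_mem hU hz i] with s hs
    refine natDegree_mul_le.trans ?_
    rw [hPdeg m _ hs, hPdeg l _ hs]
  have hpd_h : ∀ m i, ∀ z ∈ U,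
      HasDerivAt (fun s => h m (Function.update z i s)) (-(h m z * R m i z)) (z i) := by
    intro m i z hz
    obtain ⟨h1, h2, h3⟩ := hP z hz
    obtain ⟨D, hD1, hD2, -⟩ := hD m i z hz
    have key := hasDerivAt_gaussMoment hγ z i (hasDerivAt_coeff_mul hD1 hD1) (hdeg m m i z hz)
    simp only [Function.update_eq_self] at key
    rw [map_add, mul_comm D, orthogonal_of_natDegree_lt h1 h2 h3 m le_rfl D hD2, add_zero,
      zero_sub, hR' m i z hz] at key
    refine key.congr_of_eventuallyEq ?_
    filter_upwards [eventually_update_mem hU hz i] with s hs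
    exact (hh' m _ hs).symm
  have hpd_p : ∀ m i, ∀ z ∈ U, pd i (p (m + 1)) z = r (m + 1) i z := by
    intro m i z hz
    obtain ⟨h1, h2, h3⟩ := hP z hz
    obtain ⟨D, hD1, hD2, hD3⟩ := hD (m + 1) i z hz
    obtain ⟨E, hE1, hE2, -⟩ := hD m i z hz
    have key := hasDerivAt_gaussMoment hγ z i (hasDerivAt_coeff_mul hD1 hE1)
      (hdeg (m + 1) m i z hz)
    simp only [Function.update_eq_self] at key
    have key0 : HasDerivAt (fun s => gaussMoment hγ (Function.update z i s)
        (P (m + 1) (Function.update z i s) * P m (Function.update z i s))) 0 (z i) := by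
      refine (hasDerivAt_const (z i) (0 : ℝ)).congr_of_eventuallyEq ?_
      filter_upwards [eventually_update_mem hU hz i] with s hs
      exact (hP _ hs).2.2 _ _ (Nat.succ_ne_self m)
    have e := key.unique key0
    have hDn : D.natDegree ≤ m := natDegree_le_iff_coeff_eq_zero.2 fun k hk =>
      (degree_lt_iff_coeff_zero _ _).1 hD2 k hk
    rw [map_add, mul_comm D, apply_mul_of_natDegree_le h1 h2 h3 hDn,
      orthogonal_of_natDegree_lt h1 h2 h3 (m + 1) le_rfl E
        (hE2.trans (by exact_mod_cast Nat.lt_succ_self m)), add_zero, hr' m i z hz, hh' m z hz,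
      hD3 m m.lt_succ_self, ← pd_congr hU hz (hp m) i] at e
    have := (hhpos m z hz).ne'
    apply mul_left_cancel₀ this
    linarith
  have hsumR : ∀ m, ∀ z ∈ U, ∑ k, R m k z = 2 * (p m z - p (m + 1) z) := by
    intro m z hz
    obtain ⟨h1, h2, h3⟩ := hP z hz
    have e := gaussMoment_derivative hγ z (P m z * P m z)
    have hc : (X * P m z).coeff m = p m z := by
      cases m with
      | zero => rw [hp0 z hz]; simp
      | succ m => rw [coeff_X_mul, hp m z hz]
    rw [apply_derivative_mul_self h1 h2 h3, mul_left_comm, apply_mul_X_mul h1 h2 h3, hc,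
      ← hp m z hz, hh' m z hz, Finset.sum_congr rfl fun k _ => hR' m k z hz,
      ← Finset.mul_sum] at e
    have := (hhpos m z hz).ne'
    apply mul_left_cancel₀ this
    linarith
  have hsumr : ∀ m, ∀ z ∈ U, ∑ k, r (m + 1) k z = 2 * β (m + 1) z - (m + 1) := by
    intro m z hz
    obtain ⟨h1, h2, h3⟩ := hP z hz
    have e := gaussMoment_derivative hγ z (P (m + 1) z * P m z)
    rw [apply_derivative_succ_mul h1 h2 h3, mul_left_comm, apply_succ_mul_X_mul h1 h2 h3,
      hh' m z hz, hh' (m + 1) z hz, Finset.sum_congr rfl fun k _ => hr' m k z hz,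
      ← Finset.mul_sum] at e
    rw [hβ m z hz]
    have := (hhpos m z hz).ne'
    field_simp
    linarith
  have hσ' : ∀ m, ∀ z ∈ U, σ m z = 2 * p m z := by
    intro m z hz
    have e : ∀ k, pd k (fun y => Real.log (∏ i ∈ Finset.range m, h i y)) z =
        -∑ i ∈ Finset.range m, R i k z := by
      intro k
      have e1 : HasDerivAt (fun s => ∑ i ∈ Finset.range m, Real.log (h i (Function.update z k s)))
          (∑ i ∈ Finset.range m, -R i k z) (z k) := by
        refine HasDerivAt.fun_sum fun i _ => ?_
        have h0 := (hhpos i z hz).ne'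
        refine ((hpd_h i k z hz).log (by rwa [Function.update_eq_self])).congr_deriv ?_
        rw [Function.update_eq_self]
        field_simp
      rw [← Finset.sum_neg_distrib, ← e1.deriv]
      refine Filter.EventuallyEq.deriv_eq ?_
      filter_upwards [eventually_update_mem hU hz k] with s hs
      exact Real.log_prod fun i _ => (hhpos i _ hs).ne'
    rw [hσ m z hz, Finset.sum_congr rfl fun k _ => e k, Finset.sum_neg_distrib, Finset.sum_comm,
      Finset.sum_congr rfl fun i _ => hsumR i z hz, ← Finset.mul_sum, Finset.sum_range_sub',
      hp0 z hz]
    ring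
  obtain ⟨m, rfl⟩ : ∃ m, n = m + 1 := ⟨n - 1, by omega⟩
  have hpd_σ : ∀ i, ∀ z ∈ U, pd i (σ (m + 1)) z = 2 * r (m + 1) i z := by
    intro i z hz
    rw [pd_congr hU hz (hσ' (m + 1)) i, ← hpd_p m i z hz]
    exact (((hpC2 (m + 1)).hasDerivAt_pd hU hz i).const_mul 2).deriv
  have hβpos : 0 < β (m + 1) x := by
    rw [hβ m x hx]
    exact div_pos (hhpos _ x hx) (hhpos _ x hx)
  have hpd_β : pd j (β (m + 1)) x = β (m + 1) x * (R m j x - R (m + 1) j x) := by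
    rw [pd_congr hU hx (hβ m) j, hβ m x hx]
    have h0 := (hhpos m x hx).ne'
    refine ((hpd_h (m + 1) j x hx).div (hpd_h m j x hx)
      (by rwa [Function.update_eq_self])).deriv.trans ?_
    rw [Function.update_eq_self]
    field_simp
    ring
  have hsum : ∑ k, pd k (σ (m + 1)) x = 4 * β (m + 1) x - 2 * (m + 1) := by
    rw [Finset.sum_congr rfl fun k _ => hpd_σ k x hx, ← Finset.mul_sum, hsumr m x hx]
    ring
  have hsecond : ∑ k, pd k (pd j (σ (m + 1))) x =
      4 * β (m + 1) x * (R m j x - R (m + 1) j x) := by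
    have e1 : ∀ k, pd k (pd j (σ (m + 1))) x = 2 * pd j (r (m + 1) k) x := by
      intro k
      rw [pd_congr hU hx (hpd_σ j) k, ← pd_congr hU hx (hpd_p m k) j,
        pd_comm hU hx (hpC2 (m + 1)), pd_congr hU hx (hpd_p m j) k]
      exact (((hrC2 (m + 1) j).hasDerivAt_pd hU hx k).const_mul 2).deriv
    have e2 : ∑ k, pd j (r (m + 1) k) x = 2 * pd j (β (m + 1)) x := by
      have e3 : HasDerivAt (fun s => ∑ k, r (m + 1) k (Function.update x j s))
          (∑ k, pd j (r (m + 1) k) x) (x j) :=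
        HasDerivAt.fun_sum fun k _ => (hrC2 (m + 1) k).hasDerivAt_pd hU hx j
      have e4 := (((hβC2 (m + 1)).hasDerivAt_pd hU hx j).const_mul 2).sub_const ((m : ℝ) + 1)
      refine e3.unique (e4.congr_of_eventuallyEq ?_)
      filter_upwards [eventually_update_mem hU hx j] with s hs
      exact hsumr m _ hs
    rw [Finset.sum_congr rfl fun k _ => e1 k, ← Finset.mul_sum, e2, hpd_β]
    ring
  have hquad : r (m + 1) j x * (r (m + 1) j x - γ j) =
      β (m + 1) x * R (m + 1) j x * R m j x := by
    obtain ⟨h1, h2, h3⟩ := hP x hx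
    have e := pole_apply_succ_mul_sub h1 h2 h3 (gaussPoleMoment_X_sub_C_mul hγ x j) m
    have a1 := hr' m j x hx
    have a2 := hR' m j x hx
    have a3 := hR' (m + 1) j x hx
    rw [hh' m x hx] at e
    rw [hβ m x hx]
    have h0 := (hhpos m x hx).ne'
    have e' : (h m x * r (m + 1) j x) * (h m x * r (m + 1) j x - γ j * h m x) =
        (h (m + 1) x * R (m + 1) j x) * (h m x * R m j x) := by
      rw [← a1, ← a2, ← a3]
      linear_combination γ j ^ 2 * e
    field_simp
    apply mul_left_cancel₀ h0
    linear_combination e'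
  have hβeq : 2 * ((m + 1 : ℕ) : ℝ) + ∑ k, pd k (σ (m + 1)) x = 4 * β (m + 1) x := by
    rw [hsum]
    push_cast
    ring
  rw [hβeq, Finset.add_sum_erase _ (fun k => pd k (pd j (σ (m + 1))) x) (Finset.mem_univ j),
    hpd_σ j x hx, Nat.add_sub_cancel]
  obtain ⟨c1, c2⟩ := eq_root_of_quadratic_data hβpos hsecond hquad rfl
  exact ⟨c1, rfl, by positivity, c2⟩
end
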